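/- arXiv:2205.04077 — 3 statements merged into one kernel-verified Lean document; each statement's English description precedes it below -/
import Mathlib

section
/- The independence complex of a matroid of rank r ≥ k+2 on a finite nonempty ground set is k-connected (in particular, it is (r-2)-connected). -/
open scoped Classical

/-- The geometric realization of an abstract simplicial complex `K` on a finite vertex
set `V`, as the set of probability vectors on `V` whose support is a simplex of `K`. -/
noncomputable def realization {V : Type*} [Fintype V] (K : Finset V → Prop) :
    Set (V → ℝ) :=
  {f | (∀ v, 0 ≤ f v) ∧ (∑ v, f v) = 1 ∧ K (Finset.univ.filter fun v => f v ≠ 0)}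

/-- A subspace `X` of `V → ℝ` is `k`-connected: it is nonempty and every continuous
map `S^n → X` with `n ≤ k` extends continuously to the disk `D^{n+1}`. -/
def KConnected {V : Type*} [Fintype V] (X : Set (V → ℝ)) (k : ℕ) : Prop :=
  X.Nonempty ∧ ∀ n : ℕ, n ≤ k →
    ∀ f : C(Metric.sphere (0 : EuclideanSpace ℝ (Fin (n + 1))) 1, X),
      ∃ g : C(Metric.closedBall (0 : EuclideanSpace ℝ (Fin (n + 1))) 1, X),
        ∀ x : Metric.sphere (0 : EuclideanSpace ℝ (Fin (n + 1))) 1,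
          g ⟨x.1, Metric.sphere_subset_closedBall x.2⟩ = f x

/-- `μ : 2^E → ℕ` is the rank function of a matroid. -/
def IsMatroidRankFn {α : Type*} [DecidableEq α] (μ : Finset α → ℕ) : Prop :=
  μ ∅ = 0 ∧
  (∀ (A : Finset α) (x : α), μ A ≤ μ (insert x A) ∧ μ (insert x A) ≤ μ A + 1) ∧
  (∀ A B : Finset α, μ (A ∪ B) + μ (A ∩ B) ≤ μ A + μ B)

noncomputable def supp {V : Type*} [Fintype V] (f : V → ℝ) : Finset V :=
  Finset.univ.filter fun v => f v ≠ 0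

lemma mem_supp {V : Type*} [Fintype V] (f : V → ℝ) (v : V) : v ∈ supp f ↔ f v ≠ 0 := by
  simp [supp]

lemma mem_real {V : Type*} [Fintype V] {K : Finset V → Prop} {f : V → ℝ} :
    f ∈ realization K ↔ (∀ v, 0 ≤ f v) ∧ (∑ v, f v) = 1 ∧ K (supp f) := Iff.rfl

lemma coord_cont {V T : Type*} [Fintype V] [TopologicalSpace T] {K : Finset V → Prop}
    (f : C(T, realization K)) (v : V) : Continuous fun x => (f x).1 v :=
  (continuous_apply v).comp (continuous_subtype_val.comp f.continuous)

lemma supp_subset {V : Type*} [Fintype V] {f : V → ℝ} {F : Finset V} :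
    supp f ⊆ F ↔ ∀ v, v ∉ F → f v = 0 := by
  constructor
  · intro h v hv
    by_contra h0
    exact hv (h ((mem_supp f v).2 h0))
  · intro h v hv
    by_contra h0
    exact (mem_supp f v).1 hv (h v h0)

lemma mem_real_of_simplex {V : Type*} [Fintype V] {K : Finset V → Prop}
    (hK : ∀ A B : Finset V, A ⊆ B → K B → K A) {F : Finset V} (hF : K F) {f : V → ℝ}
    (h0 : ∀ v, 0 ≤ f v) (h1 : ∑ v, f v = 1) (h2 : supp f ⊆ F) : f ∈ realization K :=
  mem_real.2 ⟨h0, h1, hK _ _ h2 hF⟩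

lemma homotopic_of_simplex {V T : Type*} [Fintype V] [TopologicalSpace T] {K : Finset V → Prop}
    (hK : ∀ A B : Finset V, A ⊆ B → K B → K A) (f g : C(T, realization K))
    (h : ∀ x, ∃ F, K F ∧ supp (f x).1 ⊆ F ∧ supp (g x).1 ⊆ F) : f.Homotopic g := by
  refine ⟨⟨⟨fun p => ⟨(1 - (p.1 : ℝ)) • (f p.2).1 + (p.1 : ℝ) • (g p.2).1, ?_⟩, ?_⟩, ?_, ?_⟩⟩
  · obtain ⟨F, hF, hf, hg⟩ := h p.2
    have ff := mem_real.1 (f p.2).2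
    have gg := mem_real.1 (g p.2).2
    have p0 := p.1.2.1
    have p1 := p.1.2.2
    refine mem_real_of_simplex hK hF ?_ ?_ ?_
    · intro v
      have := ff.1 v
      have := gg.1 v
      simp only [Pi.add_apply, Pi.smul_apply, smul_eq_mul]
      have : 0 ≤ 1 - (p.1 : ℝ) := by linarith
      positivity
    · simp only [Pi.add_apply, Pi.smul_apply, smul_eq_mul, Finset.sum_add_distrib,
        ← Finset.mul_sum, ff.2.1, gg.2.1]
      ring
    · rw [supp_subset] at *
      intro v hv
      simp [hf v hv, hg v hv]
  · fun_prop
  · intro x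
    apply Subtype.ext
    simp
  · intro x
    apply Subtype.ext
    simp

lemma modify_map {V T : Type*} [Fintype V] [TopologicalSpace T] {K : Finset V → Prop}
    (hK : ∀ A B : Finset V, A ⊆ B → K B → K A) {F : Finset V} (hF : K F)
    (f : C(T, realization K)) (G : T → V → ℝ) (hG : Continuous G)
    (h : ∀ x, G x = (f x).1 ∨ (supp (f x).1 ⊆ F ∧ (∀ v, 0 ≤ G x v) ∧ ∑ v, G x v = 1 ∧
      supp (G x) ⊆ F)) :
    ∃ g : C(T, realization K), (∀ x, (g x).1 = G x) ∧ f.Homotopic g := by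
  have hmem : ∀ x, G x ∈ realization K := by
    intro x
    rcases h x with h | ⟨h1, h2, h3, h4⟩
    · rw [h]; exact (f x).2
    · exact mem_real_of_simplex hK hF h2 h3 h4
  refine ⟨⟨fun x => ⟨G x, hmem x⟩, by fun_prop⟩, fun x => rfl, ?_⟩
  apply homotopic_of_simplex hK
  intro x
  rcases h x with h | ⟨h1, h2, h3, h4⟩
  · refine ⟨supp (f x).1, (mem_real.1 (f x).2).2.2, subset_rfl, ?_⟩
    change supp (G x) ⊆ _
    rw [h]
  · exact ⟨F, hF, h1, h4⟩

/-- Collapse of an interval `[R, F]` with `R ≠ F`. -/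
lemma stepA {V T : Type*} [Fintype V] [TopologicalSpace T] {K : Finset V → Prop}
    (hK : ∀ A B : Finset V, A ⊆ B → K B → K A) {R F : Finset V} (hF : K F)
    (hRF : R ⊆ F) (hR : R.Nonempty) {a : V} (haF : a ∈ F) (haR : a ∉ R)
    (f : C(T, realization K)) (hf : ∀ x, R ⊆ supp (f x).1 → supp (f x).1 ⊆ F) :
    ∃ g : C(T, realization K), f.Homotopic g ∧ ∀ x, ¬ R ⊆ supp (g x).1 ∧
      (supp (g x).1 = supp (f x).1 ∨ supp (g x).1 ⊆ F) := by
  let m : T → ℝ := fun x => R.inf' hR (fun i => (f x).1 i)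
  have hm : Continuous m := by
    apply Continuous.finset_inf'_apply
    intro i hi
    have := coord_cont f i
    fun_prop
  let G : T → V → ℝ := fun x v =>
    (f x).1 v - m x * (if v ∈ R then 1 else 0) + m x * R.card * (if v = a then 1 else 0)
  have hG : Continuous G := by
    refine continuous_pi fun v => ?_
    have := coord_cont f v
    change Continuous fun x => (f x).1 v - m x * (if v ∈ R then 1 else 0) +
      m x * R.card * (if v = a then 1 else 0)
    fun_prop
  have hm0 : ∀ x, 0 ≤ m x := by
    intro x
    apply Finset.le_inf'
    intro i hi
    exact (mem_real.1 (f x).2).1 i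
  have hmle : ∀ x, ∀ i ∈ R, m x ≤ (f x).1 i := fun x i hi => Finset.inf'_le _ hi
  have hmex : ∀ x, ∃ i ∈ R, m x = (f x).1 i := fun x => Finset.exists_mem_eq_inf' hR _
  have key : ∀ x, G x = (f x).1 ∨ (supp (f x).1 ⊆ F ∧ (∀ v, 0 ≤ G x v) ∧ ∑ v, G x v = 1 ∧
      supp (G x) ⊆ F) := by
    intro x
    have ff := mem_real.1 (f x).2
    by_cases hx : R ⊆ supp (f x).1
    · right
      refine ⟨hf x hx, ?_, ?_, ?_⟩
      · intro v
        have h1 : 0 ≤ (f x).1 v - m x * (if v ∈ R then 1 else 0) := by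
          split_ifs with h
          · have := hmle x v h
            linarith
          · have := ff.1 v
            linarith
        have h2 : 0 ≤ m x * R.card * (if v = a then (1 : ℝ) else 0) := by
          have := hm0 x
          split_ifs <;> positivity
        exact add_nonneg h1 h2
      · simp only [G, Finset.sum_add_distrib, Finset.sum_sub_distrib, ff.2.1, ← Finset.mul_sum]
        simp
      · rw [supp_subset]
        intro v hv
        have h1 := (supp_subset.1 (hf x hx)) v hv
        have h2 : v ∉ R := fun h => hv (hRF h)
        have h3 : v ≠ a := fun h => hv (h ▸ haF)
        simp [G, h1, h2, h3]
    · left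
      obtain ⟨i, hi, hi'⟩ := Finset.not_subset.1 hx
      rw [mem_supp, not_not] at hi'
      have : m x = 0 := le_antisymm (hi' ▸ hmle x i hi) (hm0 x)
      ext v
      simp [G, this]
  obtain ⟨g, hg, hfg⟩ := modify_map hK hF f G hG key
  refine ⟨g, hfg, fun x => ⟨?_, ?_⟩⟩
  · obtain ⟨i, hi, him⟩ := hmex x
    intro hsub
    have := (mem_supp _ _).1 (hsub hi)
    apply this
    rw [hg x]
    have hia : i ≠ a := fun h => haR (h ▸ hi)
    simp [G, hi, hia, him]
  · rw [hg x]
    rcases key x with h | h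
    · left; rw [h]
    · exact Or.inr h.2.2.2

/-- Radial retraction away from an interior point `z` of `F`. -/
lemma stepB2 {V T : Type*} [Fintype V] [TopologicalSpace T] {K : Finset V → Prop}
    (hK : ∀ A B : Finset V, A ⊆ B → K B → K A) {F : Finset V} (hF : K F)
    (hFne : F.Nonempty) (z : V → ℝ) (hz0 : ∀ v ∈ F, 0 < z v) (hz1 : ∀ v, v ∉ F → z v = 0)
    (hzs : ∑ v, z v = 1)
    (f : C(T, realization K)) (hf : ∀ x, F ⊆ supp (f x).1 → supp (f x).1 ⊆ F)
    (hfz : ∀ x, (f x).1 ≠ z) :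
    ∃ g : C(T, realization K), f.Homotopic g ∧ ∀ x, ¬ F ⊆ supp (g x).1 ∧
      (supp (g x).1 = supp (f x).1 ∨ supp (g x).1 ⊆ F) := by
  let m : T → ℝ := fun x => F.inf' hFne (fun i => (f x).1 i / z i)
  have hm : Continuous m := by
    apply Continuous.finset_inf'_apply
    intro i hi
    have := coord_cont f i
    fun_prop
  have hm0 : ∀ x, 0 ≤ m x := by
    intro x
    apply Finset.le_inf'
    intro i hi
    exact div_nonneg ((mem_real.1 (f x).2).1 i) (hz0 i hi).le
  have hmle : ∀ x, ∀ i, m x * z i ≤ (f x).1 i := by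
    intro x i
    by_cases hi : i ∈ F
    · rw [← le_div_iff₀ (hz0 i hi)]
      exact Finset.inf'_le (fun i => (f x).1 i / z i) hi
    · rw [hz1 i hi, mul_zero]
      exact (mem_real.1 (f x).2).1 i
  have hmex : ∀ x, ∃ i ∈ F, m x * z i = (f x).1 i := by
    intro x
    obtain ⟨i, hi, h⟩ := Finset.exists_mem_eq_inf' hFne (fun i => (f x).1 i / z i)
    refine ⟨i, hi, ?_⟩
    rw [← eq_div_iff (hz0 i hi).ne']
    exact h
  have hzn : ∀ v, 0 ≤ z v := by
    intro v
    by_cases h : v ∈ F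
    · exact (hz0 v h).le
    · exact (hz1 v h).ge
  have hm1 : ∀ x, m x < 1 := by
    intro x
    by_contra! h
    apply hfz x
    have hle : ∀ v ∈ Finset.univ, z v ≤ (f x).1 v := by
      intro v _
      refine le_trans ?_ (hmle x v)
      nlinarith [hzn v]
    have := (Finset.sum_eq_sum_iff_of_le hle).1 (by rw [hzs, (mem_real.1 (f x).2).2.1])
    ext v
    exact (this v (Finset.mem_univ v)).symm
  let G : T → V → ℝ := fun x v => ((f x).1 v - m x * z v) / (1 - m x)
  have hG : Continuous G := by
    refine continuous_pi fun v => ?_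
    have := coord_cont f v
    refine Continuous.div (by fun_prop) (by fun_prop) ?_
    intro x
    have := hm1 x
    linarith
  have key : ∀ x, G x = (f x).1 ∨ (supp (f x).1 ⊆ F ∧ (∀ v, 0 ≤ G x v) ∧ ∑ v, G x v = 1 ∧
      supp (G x) ⊆ F) := by
    intro x
    have ff := mem_real.1 (f x).2
    have hpos : 0 < 1 - m x := by linarith [hm1 x]
    by_cases hx : F ⊆ supp (f x).1
    · right
      refine ⟨hf x hx, ?_, ?_, ?_⟩
      · intro v
        exact div_nonneg (by linarith [hmle x v]) hpos.le
      · simp only [G, ← Finset.sum_div, Finset.sum_sub_distrib, ff.2.1, ← Finset.mul_sum, hzs]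
        rw [mul_one, div_self hpos.ne']
      · rw [supp_subset]
        intro v hv
        have h1 := (supp_subset.1 (hf x hx)) v hv
        simp [G, h1, hz1 v hv]
    · left
      obtain ⟨i, hi, hi'⟩ := Finset.not_subset.1 hx
      rw [mem_supp, not_not] at hi'
      have h1 := hmle x i
      have h2 := hz0 i hi
      have : m x = 0 := by
        refine le_antisymm ?_ (hm0 x)
        rw [hi'] at h1
        nlinarith
      ext v
      simp [G, this]
  obtain ⟨g, hg, hfg⟩ := modify_map hK hF f G hG key
  refine ⟨g, hfg, fun x => ⟨?_, ?_⟩⟩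
  · obtain ⟨i, hi, him⟩ := hmex x
    intro hsub
    have := (mem_supp _ _).1 (hsub hi)
    apply this
    rw [hg x]
    simp [G, him]
  · rw [hg x]
    rcases key x with h | h
    · left; rw [h]
    · exact Or.inr h.2.2.2

lemma extend_of_null {n : ℕ} {X : Type*} [TopologicalSpace X]
    (f : C(Metric.sphere (0 : EuclideanSpace ℝ (Fin (n + 1))) 1, X)) (hf : f.Nullhomotopic) :
    ∃ g : C(Metric.closedBall (0 : EuclideanSpace ℝ (Fin (n + 1))) 1, X),
        ∀ x : Metric.sphere (0 : EuclideanSpace ℝ (Fin (n + 1))) 1,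
          g ⟨x.1, Metric.sphere_subset_closedBall x.2⟩ = f x := by
  obtain ⟨y, ⟨H⟩⟩ := hf
  let q : C(unitInterval × Metric.sphere (0 : EuclideanSpace ℝ (Fin (n + 1))) 1,
      Metric.closedBall (0 : EuclideanSpace ℝ (Fin (n + 1))) 1) :=
    ⟨fun p => ⟨(1 - (p.1 : ℝ)) • p.2.1, by
      have h1 := p.1.2.1
      have h2 := p.1.2.2
      have h3 : ‖p.2.1‖ = 1 := mem_sphere_zero_iff_norm.1 p.2.2
      rw [mem_closedBall_zero_iff, norm_smul, h3, mul_one, Real.norm_eq_abs, abs_le]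
      constructor <;> linarith⟩, by fun_prop⟩
  have hn : ∀ p, ‖(q p).1‖ = 1 - (p.1 : ℝ) := by
    intro p
    have h2 := p.1.2.2
    have h3 : ‖p.2.1‖ = 1 := mem_sphere_zero_iff_norm.1 p.2.2
    change ‖(1 - (p.1 : ℝ)) • p.2.1‖ = _
    rw [norm_smul, h3, mul_one, Real.norm_eq_abs, abs_of_nonneg (by linarith)]
  have hsurj : Function.Surjective q := by
    intro w
    have hw : ‖w.1‖ ≤ 1 := mem_closedBall_zero_iff.1 w.2
    by_cases h0 : w.1 = 0
    · obtain ⟨s, hs⟩ := (NormedSpace.sphere_nonempty (E := EuclideanSpace ℝ (Fin (n + 1)))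
        (x := 0) (r := 1)).2 zero_le_one
      refine ⟨(1, ⟨s, hs⟩), ?_⟩
      apply Subtype.ext
      simp [q, h0]
    · have hpos : 0 < ‖w.1‖ := norm_pos_iff.2 h0
      refine ⟨(⟨1 - ‖w.1‖, by constructor <;> linarith⟩, ⟨‖w.1‖⁻¹ • w.1, ?_⟩), ?_⟩
      · rw [mem_sphere_zero_iff_norm, norm_smul, norm_inv, norm_norm, inv_mul_cancel₀ hpos.ne']
      · apply Subtype.ext
        simp [q, smul_smul, mul_inv_cancel₀ hpos.ne']
  have hq : Topology.IsQuotientMap q :=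
    Topology.IsQuotientMap.of_surjective_continuous hsurj q.continuous
  have hfac : Function.FactorsThrough (H.toContinuousMap) q := by
    rintro ⟨s, a⟩ ⟨t, b⟩ hab
    have h1 := hn (s, a)
    have h2 := hn (t, b)
    rw [hab, h2] at h1
    have hst : s = t := by
      apply Subtype.ext
      simp only at h1
      linarith
    subst hst
    by_cases hs : s = 1
    · subst hs
      change H (1, a) = H (1, b)
      simp
    · have hab' : (1 - (s : ℝ)) • a.1 = (1 - (s : ℝ)) • b.1 := congrArg Subtype.val hab
      have : (1 - (s : ℝ)) ≠ 0 := by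
        intro h
        apply hs
        apply Subtype.ext
        simp only [Set.Icc.coe_one]
        linarith
      have := smul_right_injective _ this hab'
      rw [Subtype.ext this]
  refine ⟨hq.lift H.toContinuousMap hfac, ?_⟩
  intro x
  have h := congrArg (fun k => k (0, x)) (hq.lift_comp H.toContinuousMap hfac)
  have hx : q (0, x) = ⟨x.1, Metric.sphere_subset_closedBall x.2⟩ := by
    apply Subtype.ext
    simp [q]
  rw [← hx]
  refine h.trans ?_
  change H (0, x) = f x
  simp

/-- The perturbation direction. -/
noncomputable def pert {V : Type*} {N : ℕ} (e : Fin N → V) (a : V) (u : Fin N → ℝ) : V → ℝ :=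
  fun v => ∑ i, u i * ((if v = e i then 1 else 0) - (if v = a then 1 else 0))

lemma pert_sum {V : Type*} [Fintype V] {N : ℕ} (e : Fin N → V) (a : V) (u : Fin N → ℝ) :
    ∑ v, pert e a u v = 0 := by
  unfold pert
  rw [Finset.sum_comm]
  simp [← Finset.mul_sum, Finset.sum_sub_distrib]

lemma pert_abs {V : Type*} {N : ℕ} (e : Fin N → V) (a : V) (u : Fin N → ℝ) {d : ℝ}
    (hu : ∀ i, |u i| ≤ d) (v : V) : |pert e a u v| ≤ N * d := by
  unfold pert
  refine (Finset.abs_sum_le_sum_abs _ _).trans ?_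
  have : ∀ i ∈ (Finset.univ : Finset (Fin N)),
      |u i * ((if v = e i then (1 : ℝ) else 0) - (if v = a then 1 else 0))| ≤ d := by
    intro i _
    rw [abs_mul]
    have h1 : |((if v = e i then (1 : ℝ) else 0) - (if v = a then 1 else 0))| ≤ 1 := by
      split_ifs <;> norm_num
    have h2 := hu i
    have h3 := abs_nonneg (u i)
    nlinarith
  refine (Finset.sum_le_sum this).trans ?_
  simp

lemma pert_apply {V : Type*} {N : ℕ} (e : Fin N → V) (he : Function.Injective e) (a : V)
    (ha : ∀ i, e i ≠ a) (u : Fin N → ℝ) (i : Fin N) : pert e a u (e i) = u i := by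
  unfold pert
  simp [ha i, he.eq_iff]

lemma pert_off {V : Type*} {N : ℕ} (e : Fin N → V) (a : V) (u : Fin N → ℝ) (F : Finset V)
    (ha : a ∈ F) (he : ∀ i, e i ∈ F) (v : V) (hv : v ∉ F) : pert e a u v = 0 := by
  unfold pert
  apply Finset.sum_eq_zero
  intro i _
  have h1 : v ≠ e i := fun h => hv (h ▸ he i)
  have h2 : v ≠ a := fun h => hv (h ▸ ha)
  simp [h1, h2]

/-- Smooth approximation on the sphere missing a point near `b`. -/
lemma approx_miss {n : ℕ} (φ : C(Metric.sphere (0 : EuclideanSpace ℝ (Fin (n + 1))) 1,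
    Fin (n + 1) → ℝ)) (b : Fin (n + 1) → ℝ) {d : ℝ} (hd : 0 < d) :
    ∃ (h : C(Metric.sphere (0 : EuclideanSpace ℝ (Fin (n + 1))) 1, Fin (n + 1) → ℝ))
      (c : Fin (n + 1) → ℝ), (∀ x i, |h x i - φ x i| ≤ d) ∧ (∀ i, |c i - b i| ≤ d) ∧
      ∀ x, h x ≠ c := by
  obtain ⟨Φ, hΦ⟩ := ContinuousMap.exists_restrict_eq (Metric.isClosed_sphere) φ
  let Ψ : EuclideanSpace ℝ (Fin (n + 1)) → EuclideanSpace ℝ (Fin (n + 1)) :=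
    fun x => WithLp.toLp 2 (Φ x)
  have hΨ : Continuous Ψ := by
    unfold Ψ
    fun_prop
  obtain ⟨h, hh, hd', -⟩ := hΨ.exists_contDiff_approx 1 (ε := fun _ => d) continuous_const
    (fun _ => hd)
  have hnull : MeasureTheory.volume (Set.image h (Metric.sphere 0 1)) = 0 := by
    apply MeasureTheory.addHaar_image_eq_zero_of_differentiableOn_of_addHaar_eq_zero
    · exact (hh.differentiable (by simp)).differentiableOn
    · exact MeasureTheory.Measure.addHaar_sphere _ _ _
  have hex : ∃ c ∈ Metric.ball (WithLp.toLp 2 b : EuclideanSpace ℝ (Fin (n + 1))) d,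
      c ∉ Set.image h (Metric.sphere 0 1) := by
    by_contra! hcon
    have h1 := MeasureTheory.measure_mono_null hcon hnull
    exact (Metric.measure_ball_pos MeasureTheory.volume _ hd).ne' h1
  obtain ⟨c, hc, hc'⟩ := hex
  have hcoord : ∀ (y w : EuclideanSpace ℝ (Fin (n + 1))) (i), |y i - w i| ≤ dist y w := by
    intro y w i
    rw [dist_eq_norm]
    exact PiLp.norm_apply_le (y - w) i
  refine ⟨⟨fun x => WithLp.ofLp (h x.1), ?_⟩, WithLp.ofLp c, ?_, ?_, ?_⟩
  · have := hh.continuous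
    fun_prop
  · intro x i
    have h1 := (hcoord (h x.1) (Ψ x.1) i).trans (hd' x.1).le
    have h2 : Φ x.1 = φ x := congrArg (fun k => k x) hΦ
    rw [← h2]
    exact h1
  · intro i
    exact (hcoord c (WithLp.toLp 2 b) i).trans hc.le
  · intro x hx
    apply hc'
    refine ⟨x.1, x.2, ?_⟩
    exact (WithLp.ofLp_injective 2) hx

/-- General position: a sphere of dimension `n` can be made to miss an interior point of a
simplex of dimension at least `n + 1`. -/
lemma stepB1 {V : Type*} [Fintype V] {K : Finset V → Prop} {n : ℕ}
    (hK : ∀ A B : Finset V, A ⊆ B → K B → K A) {F : Finset V} (hF : K F)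
    (hcard : n + 2 ≤ F.card)
    (f : C(Metric.sphere (0 : EuclideanSpace ℝ (Fin (n + 1))) 1, realization K))
    (hf : ∀ x, F ⊆ supp (f x).1 → supp (f x).1 ⊆ F) :
    ∃ (g : C(Metric.sphere (0 : EuclideanSpace ℝ (Fin (n + 1))) 1, realization K)) (z : V → ℝ),
      f.Homotopic g ∧ (∀ x, supp (g x).1 = supp (f x).1 ∨ supp (g x).1 ⊆ F) ∧
      (∀ v ∈ F, 0 < z v) ∧ (∀ v, v ∉ F → z v = 0) ∧ ∑ v, z v = 1 ∧ ∀ x, (g x).1 ≠ z := by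
  have hFne : F.Nonempty := Finset.card_pos.1 (by omega)
  obtain ⟨a, ha⟩ := hFne
  have hc2 : Fintype.card (Fin (n + 1)) ≤ Fintype.card (F.erase a) := by
    rw [Fintype.card_fin, Fintype.card_coe, Finset.card_erase_of_mem ha]
    omega
  obtain ⟨e'⟩ := Function.Embedding.nonempty_of_card_le hc2
  let e : Fin (n + 1) → V := fun i => (e' i).1
  have he : Function.Injective e := fun i j h => e'.injective (Subtype.ext h)
  have hea : ∀ i, e i ≠ a := fun i => Finset.ne_of_mem_erase (e' i).2
  have heF : ∀ i, e i ∈ F := fun i => Finset.mem_of_mem_erase (e' i).2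
  have hFpos : (0 : ℝ) < F.card := by
    have : 0 < F.card := by omega
    exact_mod_cast this
  obtain ⟨b, hb⟩ : ∃ b : ℝ, b = 1 / F.card := ⟨_, rfl⟩
  have hbpos : 0 < b := by rw [hb]; positivity
  obtain ⟨d, hdd⟩ : ∃ d : ℝ, d = b / 4 / ((n + 1 : ℕ) : ℝ) := ⟨_, rfl⟩
  have hNpos : (0 : ℝ) < ((n + 1 : ℕ) : ℝ) := by positivity
  have hd : 0 < d := by rw [hdd]; positivity
  have hNd : ((n + 1 : ℕ) : ℝ) * d = b / 4 := by
    rw [hdd]; field_simp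
  let φ : C(Metric.sphere (0 : EuclideanSpace ℝ (Fin (n + 1))) 1, Fin (n + 1) → ℝ) :=
    ⟨fun x i => (f x).1 (e i), continuous_pi fun i => coord_cont f (e i)⟩
  obtain ⟨h, c, hh, hc, hmiss⟩ := approx_miss φ (fun _ => b) hd
  let m := fun x => F.inf' ⟨a, ha⟩ (fun i => (f x).1 i)
  have hm : Continuous m := by
    apply Continuous.finset_inf'_apply
    intro i hi
    exact coord_cont f i
  have hmle : ∀ x, ∀ i ∈ F, m x ≤ (f x).1 i := fun x i hi => Finset.inf'_le _ hi
  have hmex : ∀ x, ∃ i ∈ F, m x = (f x).1 i := fun x => Finset.exists_mem_eq_inf' _ _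
  let χ := fun x => max 0 (min 1 (4 / b * m x - 1))
  have hχ : Continuous χ := by
    unfold χ
    fun_prop
  have hχ0 : ∀ x, 0 ≤ χ x := fun x => le_max_left _ _
  have hχ1 : ∀ x, χ x ≤ 1 := fun x => max_le zero_le_one (min_le_left _ _)
  have hχz : ∀ x, m x ≤ b / 4 → χ x = 0 := by
    intro x hx
    apply max_eq_left
    apply (min_le_right _ _).trans
    have : 4 / b * m x ≤ 4 / b * (b / 4) := by gcongr
    have h2 : 4 / b * (b / 4) = 1 := by field_simp
    linarith
  have hχo : ∀ x, b / 2 ≤ m x → χ x = 1 := by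
    intro x hx
    have : 4 / b * (b / 2) ≤ 4 / b * m x := by gcongr
    have h2 : 4 / b * (b / 2) = 2 := by field_simp; norm_num
    have h3 : min 1 (4 / b * m x - 1) = 1 := min_eq_left (by linarith)
    simp only [χ, h3]
    norm_num
  let P := fun x => pert e a (fun i => h x i - φ x i)
  have hPabs : ∀ x v, |P x v| ≤ b / 4 := by
    intro x v
    rw [← hNd]
    exact pert_abs e a _ (hh x) v
  let G := fun x v => (f x).1 v + χ x * P x v
  have hG : Continuous G := by
    refine continuous_pi fun v => ?_
    have h1 := coord_cont f v
    have h2 : Continuous fun x => P x v := by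
      refine continuous_finsetSum _ fun i _ => ?_
      have h3 : Continuous fun x => h x i := (continuous_apply i).comp h.continuous
      have h4 : Continuous fun x => φ x i := (continuous_apply i).comp φ.continuous
      fun_prop
    change Continuous fun x => (f x).1 v + χ x * P x v
    fun_prop
  have key : ∀ x, G x = (f x).1 ∨ (supp (f x).1 ⊆ F ∧ (∀ v, 0 ≤ G x v) ∧ ∑ v, G x v = 1 ∧
      supp (G x) ⊆ F) := by
    intro x
    have ff := mem_real.1 (f x).2
    by_cases hx : m x ≤ b / 4
    · left
      ext v
      simp [G, hχz x hx]
    · right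
      push Not at hx
      have hsub : F ⊆ supp (f x).1 := by
        intro v hv
        rw [mem_supp]
        have := hmle x v hv
        intro h0
        linarith
      have hs := hf x hsub
      have hoff : ∀ v, v ∉ F → G x v = 0 := by
        intro v hv
        have h1 := supp_subset.1 hs v hv
        have h2 : P x v = 0 := pert_off e a _ F ha heF v hv
        simp [G, h1, h2]
      refine ⟨hs, ?_, ?_, supp_subset.2 hoff⟩
      · intro v
        by_cases hv : v ∈ F
        · have h1 := hmle x v hv
          have h2 := abs_le.1 (hPabs x v)
          have h3 := hχ0 x
          have h4 := hχ1 x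
          change 0 ≤ (f x).1 v + χ x * P x v
          nlinarith
        · exact (hoff v hv).ge
      · simp only [G, Finset.sum_add_distrib, ff.2.1, ← Finset.mul_sum]
        have : ∑ v, P x v = 0 := pert_sum e a _
        rw [this]
        ring
  obtain ⟨g, hg, hfg⟩ := modify_map hK hF f G hG key
  have hQ : ∀ v, |pert e a (fun i => c i - b) v| ≤ b / 4 := by
    intro v
    rw [← hNd]
    exact pert_abs e a _ hc v
  refine ⟨g, fun v => (if v ∈ F then b else 0) + pert e a (fun i => c i - b) v, hfg,
    ?_, ?_, ?_, ?_, ?_⟩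
  · intro x
    rw [hg x]
    rcases key x with h | h
    · left; rw [h]
    · exact Or.inr h.2.2.2
  · intro v hv
    have := abs_le.1 (hQ v)
    simp only [hv, if_true]
    linarith
  · intro v hv
    simp only [hv, if_false]
    rw [pert_off e a _ F ha heF v hv, add_zero]
  · rw [Finset.sum_add_distrib, pert_sum]
    simp [hb, hFpos.ne']
  · intro x hx
    rw [hg x] at hx
    have hGv : ∀ v, (f x).1 v + χ x * P x v =
      (if v ∈ F then b else 0) + pert e a (fun i => c i - b) v := fun v => congrFun hx v
    by_cases hmx : b / 2 ≤ m x
    · apply hmiss x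
      ext i
      have h1 := hGv (e i)
      have h2 : P x (e i) = h x i - φ x i := pert_apply e he a hea _ i
      rw [hχo x hmx, h2, pert_apply e he a hea, if_pos (heF i)] at h1
      have h3 : φ x i = (f x).1 (e i) := rfl
      linarith
    · push Not at hmx
      obtain ⟨j, hj, hjm⟩ := hmex x
      have h1 := hGv j
      rw [if_pos hj, ← hjm] at h1
      have h2 := abs_le.1 (hPabs x j)
      have h3 := abs_le.1 (hQ j)
      have h4 := hχ0 x
      have h5 := hχ1 x
      nlinarith

lemma step {V : Type*} [Fintype V] {K : Finset V → Prop} {n : ℕ}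
    (hK : ∀ A B : Finset V, A ⊆ B → K B → K A) {R F : Finset V} (hF : K F)
    (hRF : R ⊆ F) (hR : R.Nonempty) (hcard : n + 2 ≤ F.card)
    (f : C(Metric.sphere (0 : EuclideanSpace ℝ (Fin (n + 1))) 1, realization K))
    (hf : ∀ x, R ⊆ supp (f x).1 → supp (f x).1 ⊆ F) :
    ∃ g : C(Metric.sphere (0 : EuclideanSpace ℝ (Fin (n + 1))) 1, realization K),
      f.Homotopic g ∧ ∀ x, ¬ R ⊆ supp (g x).1 ∧
      (supp (g x).1 = supp (f x).1 ∨ supp (g x).1 ⊆ F) := by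
  by_cases hne : F ⊆ R
  · obtain rfl : R = F := subset_antisymm hRF hne
    obtain ⟨g, z, hfg, hg, z0, z1, zs, hgz⟩ := stepB1 hK hF hcard f hf
    obtain ⟨g', hgg, hg'⟩ := stepB2 hK hF hR z z0 z1 zs g (by
      intro x hx
      rcases hg x with h | h
      · rw [h] at hx ⊢
        exact hf x hx
      · exact h) hgz
    refine ⟨g', hfg.trans hgg, fun x => ⟨(hg' x).1, ?_⟩⟩
    rcases (hg' x).2 with h | h
    · rw [h]; exact hg x
    · exact Or.inr h
  · obtain ⟨a, ha, ha'⟩ := Finset.not_subset.1 hne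
    exact stepA hK hF hRF hR ha ha' f hf

lemma exists_weight (V : Type*) [Fintype V] [DecidableEq V] :
    ∃ (p : V → ℕ) (w : Finset V → ℕ), Function.Injective w ∧
      (∀ A B : Finset V, w A < w B → ∃ b ∈ B, b ∉ A ∧ ∀ c ∈ A, c ∉ B → p c < p b) ∧
      (∀ (B : Finset V) (b c : V), b ∈ B → c ∉ B → p c < p b → w (insert c (B.erase b)) < w B) := by
  let e := Fintype.equivFin V
  let p : V → ℕ := fun v => (e v : ℕ)
  have hp : Function.Injective p := fun a b h => e.injective (Fin.ext h)
  let w : Finset V → ℕ := fun A => ∑ a ∈ A, 2 ^ p a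
  have hw : ∀ A : Finset V, w A = ∑ k ∈ A.image p, 2 ^ k := by
    intro A
    rw [Finset.sum_image (fun a _ b _ h => hp h)]
  have hmem : ∀ (A : Finset V) a, p a ∈ A.image p ↔ a ∈ A := by
    intro A a
    rw [Finset.mem_image]
    constructor
    · rintro ⟨b, hb, h⟩
      rwa [← hp h]
    · exact fun h => ⟨a, h, rfl⟩
  refine ⟨p, w, ?_, ?_, ?_⟩
  · intro A B h
    rw [hw, hw] at h
    exact Finset.image_injective hp (Finset.geomSum_injective le_rfl h)
  · intro A B h
    rw [hw, hw, Finset.geomSum_lt_geomSum_iff_toColex_lt_toColex le_rfl,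
      Finset.Colex.toColex_lt_toColex_iff_exists_forall_lt] at h
    obtain ⟨k, hk, hkA, hall⟩ := h
    obtain ⟨b, hb, rfl⟩ := Finset.mem_image.1 hk
    refine ⟨b, hb, fun h => hkA ((hmem A b).2 h), ?_⟩
    intro c hc hcB
    exact hall (p c) ((hmem A c).2 hc) (fun h => hcB ((hmem B c).1 h))
  · intro B b c hb hc hlt
    have h1 : c ∉ B.erase b := fun h => hc (Finset.mem_of_mem_erase h)
    have h2 := Finset.add_sum_erase B (fun a => 2 ^ p a) hb
    change ∑ a ∈ insert c (B.erase b), 2 ^ p a < ∑ a ∈ B, 2 ^ p a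
    rw [Finset.sum_insert h1, ← h2]
    have : 2 ^ p c < 2 ^ p b := Nat.pow_lt_pow_right (by norm_num) hlt
    omega

section matroid
variable {E : Type*} [DecidableEq E] {μ : Finset E → ℕ}

lemma rank_mono (hμ : IsMatroidRankFn μ) (A C : Finset E) : μ A ≤ μ (A ∪ C) := by
  induction C using Finset.induction_on with
  | empty => simp
  | insert x C hx ih =>
    rw [Finset.union_insert]
    exact ih.trans (hμ.2.1 _ x).1

lemma rank_add (hμ : IsMatroidRankFn μ) (A C : Finset E) : μ (A ∪ C) ≤ μ A + C.card := by
  induction C using Finset.induction_on with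
  | empty => simp
  | insert x C hx ih =>
    rw [Finset.union_insert, Finset.card_insert_of_notMem hx]
    have := (hμ.2.1 (A ∪ C) x).2
    omega

lemma rank_le_card_mat (hμ : IsMatroidRankFn μ) (C : Finset E) : μ C ≤ C.card := by
  have := rank_add hμ ∅ C
  rw [hμ.1] at this
  simpa using this

lemma indep_sub (hμ : IsMatroidRankFn μ) (A B : Finset E) (hAB : A ⊆ B) (hB : μ B = B.card) :
    μ A = A.card := by
  have h1 := rank_add hμ A (B \ A)
  rw [Finset.union_sdiff_of_subset hAB] at h1
  have h2 := Finset.card_sdiff_add_card_eq_card hAB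
  have h3 := rank_le_card_mat hμ A
  omega

lemma rank_closure (hμ : IsMatroidRankFn μ) (A C : Finset E)
    (h : ∀ c ∈ C, μ (insert c A) = μ A) : μ (A ∪ C) = μ A := by
  induction C using Finset.induction_on with
  | empty => simp
  | insert x C hx ih =>
    have ih' := ih fun c hc => h c (Finset.mem_insert_of_mem hc)
    have h1 := hμ.2.2 (A ∪ C) (insert x A)
    have h2 := h x (Finset.mem_insert_self _ _)
    have h3 : (A ∪ C) ∪ insert x A = A ∪ insert x C := by
      ext y; simp only [Finset.mem_union, Finset.mem_insert]; tauto
    have h4 : μ A ≤ μ ((A ∪ C) ∩ insert x A) := by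
      have h5 : (A ∪ C) ∩ insert x A = A ∪ ((A ∪ C) ∩ insert x A) := by
        ext y; simp only [Finset.mem_union, Finset.mem_inter, Finset.mem_insert]; tauto
      rw [h5]
      exact rank_mono hμ _ _
    have h6 := rank_mono hμ A (insert x C)
    rw [h3] at h1
    omega

lemma indep_augment (hμ : IsMatroidRankFn μ) (A C : Finset E) (hA : μ A = A.card)
    (h : A.card < μ C) : ∃ c ∈ C, c ∉ A ∧ μ (insert c A) = (insert c A).card := by
  by_contra! hcon
  have h1 := rank_closure hμ A C (by
    intro c hc
    by_cases hcA : c ∈ A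
    · rw [Finset.insert_eq_of_mem hcA]
    · have h2 := hcon c hc hcA
      rw [Finset.card_insert_of_notMem hcA] at h2
      have h3 := hμ.2.1 A c
      omega)
  have h2 := rank_mono hμ C A
  rw [Finset.union_comm] at h2
  omega

lemma exists_basis [Fintype E] (hμ : IsMatroidRankFn μ) (d : ℕ) (A : Finset E)
    (hA : μ A = A.card) (hd : A.card + d = μ Finset.univ) :
    ∃ B, A ⊆ B ∧ μ B = B.card ∧ B.card = μ Finset.univ := by
  induction d generalizing A with
  | zero => exact ⟨A, subset_rfl, hA, hd⟩
  | succ d ih =>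
    obtain ⟨c, -, hc, hi⟩ := indep_augment hμ A Finset.univ hA (by omega)
    obtain ⟨B, hB, hB'⟩ := ih (insert c A) hi (by
      rw [Finset.card_insert_of_notMem hc]; omega)
    exact ⟨B, (Finset.subset_insert _ _).trans hB, hB'⟩

end matroid

lemma null_all {E : Type*} [Fintype E] [DecidableEq E]
    (μ : Finset E → ℕ) (hμ : IsMatroidRankFn μ) (n : ℕ) (hrank : n + 2 ≤ μ Finset.univ)
    (f : C(Metric.sphere (0 : EuclideanSpace ℝ (Fin (n + 1))) 1,
      realization fun A : Finset E => μ A = A.card)) : f.Nullhomotopic := by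
  obtain ⟨p, w, hwinj, hw1, hw2⟩ := exists_weight E
  have hK : ∀ A B : Finset E, A ⊆ B → μ B = B.card → μ A = A.card := indep_sub hμ
  obtain ⟨s, hs⟩ := (NormedSpace.sphere_nonempty (E := EuclideanSpace ℝ (Fin (n + 1)))
        (x := 0) (r := 1)).2 zero_le_one
  have main : ∀ c : ℕ, ∀ f : C(Metric.sphere (0 : EuclideanSpace ℝ (Fin (n + 1))) 1,
      realization fun A : Finset E => μ A = A.card),
      (∀ x, ∃ B, supp (f x).1 ⊆ B ∧ μ B = B.card ∧ B.card = μ Finset.univ ∧ w B < c) →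
      f.Nullhomotopic := by
    intro c
    induction c with
    | zero =>
      intro f hf
      obtain ⟨B, -, -, -, h⟩ := hf ⟨s, hs⟩
      omega
    | succ c ih =>
      intro f hf
      by_cases hex : ∃ F, μ F = F.card ∧ F.card = μ Finset.univ ∧ w F = c
      swap
      · apply ih
        intro x
        obtain ⟨B, h1, h2, h3, h4⟩ := hf x
        refine ⟨B, h1, h2, h3, ?_⟩
        have : w B ≠ c := fun h => hex ⟨B, h2, h3, h⟩
        omega
      obtain ⟨F, hF, hFr, hFc⟩ := hex
      let R := F.filter fun b => ∃ y, y ∉ F ∧ p y < p b ∧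
        μ (insert y (F.erase b)) = (insert y (F.erase b)).card
      have hRF : R ⊆ F := Finset.filter_subset _ _
      have key : ∀ A B : Finset E, R ⊆ A → A ⊆ B → μ B = B.card → B.card = μ Finset.univ →
          ¬ w B < c := by
        intro A B hRA hAB hB hBr hlt
        rw [← hFc] at hlt
        obtain ⟨b, hbF, hbB, hall⟩ := hw1 B F hlt
        obtain ⟨y, hyB, hyF, hy⟩ := indep_augment hμ (F.erase b) B
          (hK _ _ (Finset.erase_subset _ _) hF) (by
            rw [Finset.card_erase_of_mem hbF, hB, hBr, hFr]
            omega)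
        have hyb : y ≠ b := fun h => hbB (h ▸ hyB)
        have hyF' : y ∉ F := fun h => hyF (Finset.mem_erase.2 ⟨hyb, h⟩)
        have : b ∈ R := Finset.mem_filter.2 ⟨hbF, y, hyF', hall y hyB hyF', hy⟩
        exact hbB (hAB (hRA this))
      have huniq : ∀ B, w B < c + 1 → ¬ w B < c → B = F := by
        intro B h1 h2
        apply hwinj
        omega
      by_cases hR : R.Nonempty
      · obtain ⟨g, hfg, hg⟩ := step hK hF hRF hR (by omega) f (by
          intro x hx
          obtain ⟨B, h1, h2, h3, h4⟩ := hf x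
          rw [← huniq B h4 (key _ B hx h1 h2 h3)]
          exact h1)
        obtain ⟨y, hy⟩ := ih g (by
          intro x
          have hsub : ∀ A : Finset E, ¬ R ⊆ A → A ⊆ F → ∃ B, A ⊆ B ∧ μ B = B.card ∧
              B.card = μ Finset.univ ∧ w B < c := by
            intro A hRA hAF
            obtain ⟨b, hbR, hbA⟩ := Finset.not_subset.1 hRA
            obtain ⟨hbF, y, hyF, hpy, hy⟩ := Finset.mem_filter.1 hbR
            refine ⟨insert y (F.erase b), ?_, hy, ?_, ?_⟩
            · intro t ht
              refine Finset.mem_insert_of_mem (Finset.mem_erase.2 ⟨?_, hAF ht⟩)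
              rintro rfl
              exact hbA ht
            · rw [Finset.card_insert_of_notMem (fun h => hyF (Finset.mem_of_mem_erase h)),
                Finset.card_erase_of_mem hbF]
              omega
            · rw [← hFc]
              exact hw2 F b y hbF hyF hpy
          obtain ⟨h1, h2 | h2⟩ := hg x
          · obtain ⟨B, b1, b2, b3, b4⟩ := hf x
            by_cases hB : w B < c
            · exact ⟨B, h2 ▸ b1, b2, b3, hB⟩
            · apply hsub _ h1
              rw [h2, ← huniq B b4 hB]
              exact b1
          · exact hsub _ h1 h2)
        exact ⟨y, hfg.trans hy⟩
      · rw [Finset.not_nonempty_iff_eq_empty] at hR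
        have hall : ∀ x, supp (f x).1 ⊆ F := by
          intro x
          obtain ⟨B, h1, h2, h3, h4⟩ := hf x
          rw [← huniq B h4 (key ∅ B (by rw [hR]) (Finset.empty_subset _) h2 h3)]
          exact h1
        refine ⟨f ⟨s, hs⟩, homotopic_of_simplex hK _ _ fun x => ⟨F, hF, hall x, hall _⟩⟩
  apply main ((Finset.univ.sup w) + 1) f
  intro x
  have hx := (mem_real.1 (f x).2).2.2
  have hle : (supp (f x).1).card ≤ μ Finset.univ := by
    rw [← hx]
    have := rank_mono hμ (supp (f x).1) Finset.univ
    rwa [Finset.union_eq_right.2 (Finset.subset_univ _)] at this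
  obtain ⟨B, h1, h2, h3⟩ := exists_basis hμ (μ Finset.univ - (supp (f x).1).card) _ hx (by omega)
  exact ⟨B, h1, h2, h3, Nat.lt_succ_of_le (Finset.le_sup (f := w) (Finset.mem_univ B))⟩

lemma real_nonempty {E : Type*} [Fintype E] [DecidableEq E]
    (μ : Finset E → ℕ) (hμ : IsMatroidRankFn μ) (hrank : 2 ≤ μ Finset.univ) :
    (realization fun A : Finset E => μ A = A.card).Nonempty := by
  obtain ⟨c, -, hc, hi⟩ := indep_augment hμ ∅ Finset.univ (by simp [hμ.1]) (by simp; omega)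
  refine ⟨fun v => if v = c then 1 else 0,
    mem_real_of_simplex (K := fun A : Finset E => μ A = A.card) (indep_sub hμ) hi ?_ ?_ ?_⟩
  · intro v
    split_ifs <;> norm_num
  · simp
  · rw [supp_subset]
    intro v hv
    simp at hv
    simp [hv]

/-- The independence complex of a matroid of rank `r ≥ k + 2` on a
finite nonempty ground set is `k`-connected. -/
theorem independence_complex_kConnected
    {E : Type*} [Fintype E] [DecidableEq E] [Nonempty E]
    (μ : Finset E → ℕ) (hμ : IsMatroidRankFn μ) (k : ℕ)
    (hrank : k + 2 ≤ μ Finset.univ) :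
    KConnected (realization fun A : Finset E => μ A = A.card) k := by
  refine ⟨real_nonempty μ hμ (by omega), fun n hn f => ?_⟩
  exact extend_of_null f (null_all μ hμ n (by omega) f)
end

section
/- There is no continuous ℤ₂-equivariant map from the sphere S^{k+1} to ℝ^{k+1} \ {0} (with the antipodal ℤ₂-actions on both spaces). -/
namespace BU
open Polynomial in
theorem odd_root (p : ℝ[X]) (hp : p.Monic) (hodd : Odd p.natDegree) : ∃ x, p.IsRoot x := by
  have hpos : 0 < p.natDegree := hodd.pos
  have h1 := p.tendsto_atTop_of_leadingCoeff_nonneg (natDegree_pos_iff_degree_pos.1 hpos)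
    (by rw [hp.leadingCoeff]; norm_num)
  have hnd : (p.comp (-X)).natDegree = p.natDegree := by simp [natDegree_comp]
  have h2 := (p.comp (-X)).tendsto_atBot_of_leadingCoeff_nonpos
    (natDegree_pos_iff_degree_pos.1 (hnd ▸ hpos))
    (by rw [leadingCoeff_comp (by simp)]; simp [hp.leadingCoeff, hodd.neg_one_pow])
  obtain ⟨a, ha⟩ := (h1.eventually (Filter.eventually_ge_atTop 0)).exists
  obtain ⟨b, hb⟩ := (h2.eventually (Filter.eventually_le_atBot 0)).exists
  have := mem_range_of_exists_le_of_exists_ge (c := (0:ℝ)) p.continuous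
    ⟨-b, by simpa using hb⟩ ⟨a, ha⟩
  simpa [IsRoot] using this

theorem common_eigenvector {ι : Type*} : ∀ (d : ℕ) (V : Type) [AddCommGroup V] [Module ℝ V]
    [FiniteDimensional ℝ V] (S : ι → Module.End ℝ V), (∀ i j, Commute (S i) (S j)) →
    Module.finrank ℝ V = d → Odd d → ∃ v : V, v ≠ 0 ∧ ∀ i, ∃ c : ℝ, S i v = c • v := by
  intro d
  induction d using Nat.strong_induction_on with
  | _ d ih =>
  intro V _ _ _ S hS hd hodd
  have hnt : Nontrivial V := Module.nontrivial_of_finrank_pos (R := ℝ) (hd ▸ hodd.pos)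
  by_cases hsc : ∀ i, ∃ c : ℝ, S i = c • (1 : Module.End ℝ V)
  · obtain ⟨v, hv⟩ := exists_ne (0 : V)
    refine ⟨v, hv, fun i => ?_⟩
    obtain ⟨c, hc⟩ := hsc i
    exact ⟨c, by simp [hc]⟩
  push Not at hsc
  obtain ⟨i₀, hi₀⟩ := hsc
  obtain ⟨μ, hμ⟩ := odd_root (S i₀).charpoly (LinearMap.charpoly_monic _)
    (by rw [LinearMap.charpoly_natDegree, hd]; exact hodd)
  rw [← Module.End.hasEigenvalue_iff_isRoot_charpoly] at hμ
  obtain ⟨e, he⟩ := hμ.exists_hasEigenvector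
  set N : Module.End ℝ V := S i₀ - μ • 1 with hN
  have hNe : N e = 0 := by simp [hN, he.apply_eq_smul]
  have hcomm : ∀ i, Commute (S i) N := fun i =>
    (hS i i₀).sub_right ((Commute.one_right _).smul_right μ)
  have hcomm' : ∀ i v, S i (N v) = N (S i v) := fun i v => by
    have := congrArg (fun f : Module.End ℝ V => f v) (hcomm i).eq
    simpa using this
  have hsum := N.finrank_range_add_finrank_ker
  have hker_pos : 0 < Module.finrank ℝ (LinearMap.ker N) := by
    rw [Module.finrank_pos_iff]
    exact ⟨⟨⟨e, hNe⟩, 0, fun h => he.2 (congrArg Subtype.val h)⟩⟩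
  have hran_pos : 0 < Module.finrank ℝ (LinearMap.range N) := by
    rw [Nat.pos_iff_ne_zero]
    intro h
    rw [Submodule.finrank_eq_zero, LinearMap.range_eq_bot] at h
    exact hi₀ μ (sub_eq_zero.1 h)
  have main : ∀ W : Submodule ℝ V, (∀ i, ∀ x ∈ W, S i x ∈ W) → Module.finrank ℝ W < d →
      Odd (Module.finrank ℝ W) → ∃ v : V, v ≠ 0 ∧ ∀ i, ∃ c : ℝ, S i v = c • v := by
    intro W hW hlt ho
    obtain ⟨v, hv, h⟩ := ih _ hlt W (fun i => (S i).restrict (hW i)) (fun i j => by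
      ext x
      have := congrArg (fun f : Module.End ℝ V => f x) (hS i j).eq
      simpa using this) rfl ho
    refine ⟨v, by simpa using hv, fun i => ?_⟩
    obtain ⟨c, hc⟩ := h i
    exact ⟨c, by simpa using congrArg Subtype.val hc⟩
  rcases Nat.even_or_odd (Module.finrank ℝ (LinearMap.ker N)) with hk | hk
  · refine main (LinearMap.range N) ?_ (by omega) ?_
    · rintro i _ ⟨y, rfl⟩
      exact ⟨S i y, (hcomm' i y).symm⟩
    · rw [← hd, ← hsum, Nat.odd_add] at hodd
      exact hodd.2 hk
  · refine main (LinearMap.ker N) ?_ (by omega) hk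
    intro i x hx
    rw [LinearMap.mem_ker] at hx ⊢
    rw [← hcomm', hx, map_zero]
end BU
namespace BU
open MvPolynomial Finsupp
section G
set_option linter.unusedSectionVars false
variable {σ : Type} [Fintype σ] [DecidableEq σ]

/-- polynomials all of whose monomials have weight `< k` -/
noncomputable def low (w : σ → ℕ) (k : ℕ) : Submodule ℝ (MvPolynomial σ ℝ) :=
  restrictSupport ℝ {m | weight w m < k}

theorem mem_low {w : σ → ℕ} {k : ℕ} {p : MvPolynomial σ ℝ} :
    p ∈ low w k ↔ ∀ m ∈ p.support, weight w m < k := Iff.rfl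

theorem low_mono {w : σ → ℕ} {k l : ℕ} (h : k ≤ l) : low w k ≤ low w l :=
  restrictSupport_mono _ (fun _ hm => lt_of_lt_of_le hm h)

theorem mem_low_zero {w : σ → ℕ} {p : MvPolynomial σ ℝ} (h : p ∈ low w 0) : p = 0 := by
  rw [← MvPolynomial.support_eq_empty]
  exact Finset.eq_empty_of_forall_notMem fun m hm => Nat.not_lt_zero _ (h hm)

theorem exists_low (w : σ → ℕ) (p : MvPolynomial σ ℝ) : ∃ k, p ∈ low w k := by
  refine ⟨p.support.sup (weight w) + 1, fun m hm => ?_⟩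
  exact Nat.lt_succ_of_le (Finset.le_sup (f := weight w) hm)

theorem mul_mem_low {w : σ → ℕ} {k l r : ℕ} {p q : MvPolynomial σ ℝ}
    (hp : ∀ m ∈ p.support, weight w m ≤ k) (hq : ∀ m ∈ q.support, weight w m ≤ l)
    (h : (∀ m ∈ p.support, weight w m < k) ∨ (∀ m ∈ q.support, weight w m < l))
    (hr : r = k + l) : p * q ∈ low w r := by
  rw [mem_low]
  intro m hm
  obtain ⟨a, ha, b, hb, rfl⟩ := Finset.mem_add.1 (support_mul p q hm)
  rw [map_add]
  have h1 := hp a ha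
  have h2 := hq b hb
  rcases h with h | h
  · have := h a ha; omega
  · have := h b hb; omega

/-- `p = X^m + ` lower terms -/
def Lead (w : σ → ℕ) (p : MvPolynomial σ ℝ) (m : σ →₀ ℕ) : Prop :=
  p - monomial m 1 ∈ low w (weight w m)

theorem Lead.mon (w : σ → ℕ) (m : σ →₀ ℕ) : Lead w (monomial m 1) m := by
  simp [Lead]

theorem Lead.mul {w : σ → ℕ} {p q : MvPolynomial σ ℝ} {m n : σ →₀ ℕ}
    (hp : Lead w p m) (hq : Lead w q n) : Lead w (p * q) (m + n) := by
  unfold Lead at *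
  have hm : ∀ m : σ →₀ ℕ, ∀ a ∈ (monomial m (1:ℝ)).support, weight w a ≤ weight w m := by
    intro m a ha
    rw [Finset.mem_singleton.1 (support_monomial_subset ha)]
  have e : p * q - monomial (m + n) 1 = (p - monomial m 1) * (q - monomial n 1)
      + monomial m 1 * (q - monomial n 1) + (p - monomial m 1) * monomial n 1 := by
    have : (monomial (m + n) (1:ℝ)) = monomial m 1 * monomial n 1 := by simp [monomial_mul]
    rw [this]; ring
  rw [e]
  have hp' := mem_low.1 hp
  have hq' := mem_low.1 hq
  refine add_mem (add_mem ?_ ?_) ?_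
  · exact mul_mem_low (fun a ha => (hp' a ha).le) (fun a ha => (hq' a ha).le) (Or.inl hp')
      (map_add _ _ _)
  · exact mul_mem_low (hm m) (fun a ha => (hq' a ha).le) (Or.inr hq') (map_add _ _ _)
  · exact mul_mem_low (fun a ha => (hp' a ha).le) (hm n) (Or.inl hp') (map_add _ _ _)

theorem Lead.pow {w : σ → ℕ} {p : MvPolynomial σ ℝ} {m : σ →₀ ℕ}
    (hp : Lead w p m) (k : ℕ) : Lead w (p ^ k) (k • m) := by
  induction k with
  | zero => simpa using Lead.mon w (0 : σ →₀ ℕ)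
  | succ k ih => rw [pow_succ, succ_nsmul]; exact ih.mul hp

theorem Lead.prod {w : σ → ℕ} (s : Finset σ) (p : σ → MvPolynomial σ ℝ) (m : σ → σ →₀ ℕ)
    (h : ∀ i, Lead w (p i) (m i)) : Lead w (∏ i ∈ s, p i) (∑ i ∈ s, m i) := by
  induction s using Finset.induction_on with
  | empty => simpa using Lead.mon w (0 : σ →₀ ℕ)
  | insert a s ha ih => rw [Finset.prod_insert ha, Finset.sum_insert ha]; exact (h a).mul ih

/-- the adapted basis -/
noncomputable def ee (F : σ → MvPolynomial σ ℝ) (D : σ → ℕ) (m : σ →₀ ℕ) : MvPolynomial σ ℝ :=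
  ∏ i, (F i ^ (m i / D i) * X i ^ (m i % D i))

theorem ee_lead {w D : σ → ℕ} {F : σ → MvPolynomial σ ℝ}
    (hF : ∀ i, Lead w (F i) (single i (D i))) (m : σ →₀ ℕ) : Lead w (ee F D m) m := by
  have h := Lead.prod (w := w) Finset.univ
    (fun i => F i ^ (m i / D i) * X i ^ (m i % D i))
    (fun i => (m i / D i) • single i (D i) + (m i % D i) • single i 1)
    (fun i => ((hF i).pow _).mul ((Lead.mon w (single i 1)).pow _))
  have e : ∑ i, ((m i / D i) • single i (D i) + (m i % D i) • single i 1) = m := by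
    conv_rhs => rw [← Finsupp.univ_sum_single m]
    refine Finset.sum_congr rfl fun i _ => ?_
    rw [smul_single, smul_single, ← single_add]
    congr 1
    simp only [smul_eq_mul, mul_one]
    exact Nat.div_add_mod' _ _
  rw [e] at h
  exact h

theorem ee_mul {D : σ → ℕ} (hD : ∀ i, 0 < D i) (F : σ → MvPolynomial σ ℝ) (m : σ →₀ ℕ) (i : σ) :
    F i * ee F D m = ee F D (m + single i (D i)) := by
  unfold ee
  rw [← Finset.mul_prod_erase _ _ (Finset.mem_univ i),
    ← Finset.mul_prod_erase _ (fun j => F j ^ ((m + single i (D i)) j / D j) * _)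
      (Finset.mem_univ i)]
  have : ∏ x ∈ Finset.univ.erase i, F x ^ (m x / D x) * X x ^ (m x % D x) =
      ∏ x ∈ Finset.univ.erase i, F x ^ ((m + single i (D i)) x / D x) *
        X x ^ ((m + single i (D i)) x % D x) := by
    refine Finset.prod_congr rfl fun j hj => ?_
    have : (m + single i (D i)) j = m j := by
      simp [(Finset.ne_of_mem_erase hj).symm]
    rw [this]
  rw [this]
  simp only [Finsupp.add_apply, single_eq_same, Nat.add_div_right _ (hD i), Nat.add_mod_right,
    pow_succ]
  ring

theorem ee_box {D : σ → ℕ} (F : σ → MvPolynomial σ ℝ) (m : σ →₀ ℕ) (hm : ∀ i, m i < D i) :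
    ee F D m = monomial m 1 := by
  unfold ee
  rw [monomial_eq, Finsupp.prod_fintype _ _ (by simp)]
  simp only [map_one, one_mul]
  refine Finset.prod_congr rfl fun i _ => ?_
  rw [Nat.div_eq_of_lt (hm i), Nat.mod_eq_of_lt (hm i)]; simp

noncomputable def TT (F : σ → MvPolynomial σ ℝ) (D : σ → ℕ) :
    MvPolynomial σ ℝ →ₗ[ℝ] MvPolynomial σ ℝ :=
  (basisMonomials σ ℝ).constr ℝ (ee F D)

theorem TT_mon (F : σ → MvPolynomial σ ℝ) (D : σ → ℕ) (m : σ →₀ ℕ) :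
    TT F D (monomial m 1) = ee F D m := by
  have := (basisMonomials σ ℝ).constr_basis ℝ (ee F D) m
  simpa [TT] using this

theorem TT_low {w D : σ → ℕ} {F : σ → MvPolynomial σ ℝ}
    (hF : ∀ i, Lead w (F i) (single i (D i))) (k : ℕ) (p : MvPolynomial σ ℝ)
    (hp : p ∈ low w (k + 1)) : TT F D p - p ∈ low w k := by
  have : low w (k + 1) ≤ (low w k).comap (TT F D - LinearMap.id) := by
    unfold low
    rw [restrictSupport_eq_span, Submodule.span_le]
    rintro _ ⟨m, hm, rfl⟩
    change TT F D (monomial m 1) - monomial m 1 ∈ low w k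
    rw [TT_mon]
    exact low_mono (Nat.lt_succ_iff.1 hm) (ee_lead hF m)
  exact this hp

theorem TT_inj {w D : σ → ℕ} {F : σ → MvPolynomial σ ℝ}
    (hF : ∀ i, Lead w (F i) (single i (D i))) : Function.Injective (TT F D) := by
  rw [← LinearMap.ker_eq_bot, LinearMap.ker_eq_bot']
  intro p hp
  obtain ⟨k, hk⟩ := exists_low w p
  induction k with
  | zero => exact mem_low_zero hk
  | succ k ih =>
    apply ih
    have := TT_low hF k p hk
    rw [hp, zero_sub, neg_mem_iff] at this
    exact this

theorem TT_surj {w D : σ → ℕ} {F : σ → MvPolynomial σ ℝ}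
    (hF : ∀ i, Lead w (F i) (single i (D i))) : Function.Surjective (TT F D) := by
  intro p
  obtain ⟨k, hk⟩ := exists_low w p
  induction k generalizing p with
  | zero => exact ⟨0, by rw [mem_low_zero hk, map_zero]⟩
  | succ k ih =>
    obtain ⟨q, hq⟩ := ih _ (TT_low hF k p hk)
    exact ⟨p - q, by rw [map_sub, hq]; abel⟩

theorem ee_li {w D : σ → ℕ} {F : σ → MvPolynomial σ ℝ}
    (hF : ∀ i, Lead w (F i) (single i (D i))) : LinearIndependent ℝ (ee F D) := by
  have := (basisMonomials σ ℝ).linearIndependent.map' (TT F D)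
    (LinearMap.ker_eq_bot.2 (TT_inj hF))
  have e : ee F D = TT F D ∘ basisMonomials σ ℝ := by
    ext1 m
    simp [TT_mon]
  rw [e]
  exact this

theorem ee_span {w D : σ → ℕ} {F : σ → MvPolynomial σ ℝ}
    (hF : ∀ i, Lead w (F i) (single i (D i))) : Submodule.span ℝ (Set.range (ee F D)) = ⊤ := by
  have h : Set.range (ee F D) = TT F D '' Set.range (basisMonomials σ ℝ) := by
    rw [← Set.range_comp]
    congr 1
    ext1 m
    simp [TT_mon]
  rw [h, Submodule.span_image, (basisMonomials σ ℝ).span_eq, Submodule.map_top,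
    LinearMap.range_eq_top]
  exact TT_surj hF

def box (D : σ → ℕ) : Set (σ →₀ ℕ) := {m | ∀ i, m i < D i}

theorem ideal_le {w D : σ → ℕ} (hD : ∀ i, 0 < D i) {F : σ → MvPolynomial σ ℝ}
    (hF : ∀ i, Lead w (F i) (single i (D i))) (p : MvPolynomial σ ℝ)
    (hp : p ∈ Ideal.span (Set.range F)) : p ∈ Submodule.span ℝ (ee F D '' (box D)ᶜ) := by
  have key : ∀ (q : MvPolynomial σ ℝ) (i : σ),
      q * F i ∈ Submodule.span ℝ (ee F D '' (box D)ᶜ) := by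
    intro q i
    have hq : q ∈ Submodule.span ℝ (Set.range (ee F D)) := by rw [ee_span hF]; trivial
    induction hq using Submodule.span_induction with
    | mem x hx =>
      obtain ⟨m, rfl⟩ := hx
      rw [mul_comm, ee_mul hD]
      refine Submodule.subset_span ⟨_, ?_, rfl⟩
      intro hb
      have := hb i
      simp at this
    | zero => simp
    | add x y _ _ hx hy => rw [add_mul]; exact add_mem hx hy
    | smul a x _ hx => rw [smul_mul_assoc]; exact Submodule.smul_mem _ _ hx
  induction hp using Submodule.span_induction with
  | mem x hx => obtain ⟨i, rfl⟩ := hx; simpa using key 1 i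
  | zero => simp
  | add x y _ _ hx hy => exact add_mem hx hy
  | smul a x hx' hx =>
    clear hx
    induction hx' using Submodule.span_induction generalizing a with
    | mem x hx => obtain ⟨i, rfl⟩ := hx; exact key a i
    | zero => simp
    | add x y _ _ hx hy => rw [smul_add]; exact add_mem (hx a) (hy a)
    | smul b x _ hx => rw [smul_smul]; exact hx _

theorem box_disjoint {w D : σ → ℕ} (hD : ∀ i, 0 < D i) {F : σ → MvPolynomial σ ℝ}
    (hF : ∀ i, Lead w (F i) (single i (D i))) (p : MvPolynomial σ ℝ)
    (hp : p ∈ Ideal.span (Set.range F)) (hb : p ∈ restrictSupport ℝ (box D)) : p = 0 := by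
  have h1 := ideal_le hD hF p hp
  have h2 : p ∈ Submodule.span ℝ (ee F D '' (box D)) := by
    rw [restrictSupport_eq_span] at hb
    have e : ee F D '' (box D) = (fun m => monomial m (1:ℝ)) '' (box D) :=
      Set.image_congr fun m hm => ee_box F m hm
    rw [e]
    exact hb
  exact Submodule.disjoint_def.1 ((ee_li hF).disjoint_span_image disjoint_compl_right) p h2 h1

theorem box_spanning {w D : σ → ℕ} {F : σ → MvPolynomial σ ℝ}
    (hF : ∀ i, Lead w (F i) (single i (D i))) (p : MvPolynomial σ ℝ) :
    ∃ b ∈ restrictSupport ℝ (box D), p - b ∈ Ideal.span (Set.range F) := by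
  have hq : p ∈ Submodule.span ℝ (Set.range (ee F D)) := by rw [ee_span hF]; trivial
  induction hq using Submodule.span_induction with
  | mem x hx =>
    obtain ⟨m, rfl⟩ := hx
    by_cases hm : m ∈ box D
    · refine ⟨monomial m 1, by simp [hm], ?_⟩
      rw [ee_box F m hm]; simp
    · refine ⟨0, zero_mem _, ?_⟩
      rw [sub_zero]
      have : ∃ i, D i ≤ m i := by simpa [box] using hm
      obtain ⟨i, hi⟩ := this
      by_cases hDi : D i = 0
      · -- then F i has leading term 1 of weight zero
        have h1 : F i = 1 := by
          have := hF i
          rw [hDi] at this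
          simp only [Lead, single_zero, map_zero] at this
          have := mem_low_zero this
          rw [sub_eq_zero] at this
          simpa using this
        rw [Ideal.eq_top_of_unit_mem _ (F i) 1 (Ideal.subset_span (Set.mem_range_self i)) (by simp [h1])]
        trivial
      · unfold ee
        rw [← Finset.mul_prod_erase _ _ (Finset.mem_univ i)]
        refine Ideal.mul_mem_right _ _ (Ideal.mul_mem_right _ _ ?_)
        exact Ideal.pow_mem_of_mem _ (Ideal.subset_span (Set.mem_range_self i)) _
          (Nat.div_pos hi (Nat.pos_of_ne_zero hDi))
  | zero => exact ⟨0, zero_mem _, by simp⟩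
  | add x y _ _ hx hy =>
    obtain ⟨b, hb, hb'⟩ := hx
    obtain ⟨c, hc, hc'⟩ := hy
    exact ⟨b + c, add_mem hb hc, by rw [add_sub_add_comm]; exact add_mem hb' hc'⟩
  | smul a x _ hx =>
    obtain ⟨b, hb, hb'⟩ := hx
    refine ⟨a • b, Submodule.smul_mem _ _ hb, ?_⟩
    rw [← smul_sub, smul_eq_C_mul]
    exact Ideal.mul_mem_left _ _ hb'
end G
end BU
namespace BU
open MvPolynomial Finsupp
section H
set_option linter.unusedSectionVars false
variable {σ : Type} [Fintype σ] [DecidableEq σ]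

noncomputable def tau (σ : Type) : MvPolynomial σ ℝ →ₐ[ℝ] MvPolynomial σ ℝ := aeval (fun i => -X i)

theorem tau_mon (m : σ →₀ ℕ) : tau σ (monomial m 1) = (-1 : ℝ) ^ (degree m) • monomial m 1 := by
  rw [tau, aeval_monomial, monomial_eq, Finsupp.prod_fintype _ _ (by simp),
    Finsupp.prod_fintype _ _ (by simp), degree_eq_sum, ← Finset.prod_pow_eq_pow_sum]
  simp_rw [neg_pow (X _ : MvPolynomial σ ℝ), Finset.prod_mul_distrib]
  simp [smul_eq_C_mul]

theorem tau_ideal {F : σ → MvPolynomial σ ℝ} (hτ : ∀ i, tau σ (F i) = F i ∨ tau σ (F i) = -F i)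
    (p : MvPolynomial σ ℝ) (hp : p ∈ Ideal.span (Set.range F)) :
    tau σ p ∈ Ideal.span (Set.range F) := by
  have : Ideal.span (Set.range F) ≤ (Ideal.span (Set.range F)).comap (tau σ) := by
    rw [Ideal.span_le]
    rintro _ ⟨i, rfl⟩
    have hi : F i ∈ Ideal.span (Set.range F) := Ideal.subset_span (Set.mem_range_self i)
    rcases hτ i with h | h
    · simpa [h] using hi
    · simpa [h] using hi
  exact this hp

def ebox (D : σ → ℕ) : Set (σ →₀ ℕ) := {m | m ∈ box D ∧ Even (degree m)}

theorem sym_box {D : σ → ℕ} (c : MvPolynomial σ ℝ) (hc : c ∈ restrictSupport ℝ (box D)) :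
    c + tau σ c ∈ restrictSupport ℝ (ebox D) := by
  rw [restrictSupport_eq_span] at hc
  induction hc using Submodule.span_induction with
  | mem x hx =>
    obtain ⟨m, hm, rfl⟩ := hx
    simp only [tau_mon]
    rcases Nat.even_or_odd (degree m) with h | h
    · have : (monomial m (1:ℝ)) ∈ restrictSupport ℝ (ebox D) := by
        simp only [monomial_mem_restrictSupport]; exact Or.inl ⟨hm, h⟩
      exact add_mem this (Submodule.smul_mem _ _ this)
    · simp [h.neg_one_pow]
  | zero => simp
  | add x y _ _ hx hy =>
    rw [map_add, add_add_add_comm]; exact add_mem hx hy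
  | smul a x _ hx => rw [map_smul, ← smul_add]; exact Submodule.smul_mem _ _ hx

noncomputable def evenAlg (F : σ → MvPolynomial σ ℝ) :
    Subalgebra ℝ (MvPolynomial σ ℝ ⧸ Ideal.span (Set.range F)) :=
  (AlgHom.equalizer (tau σ) (AlgHom.id ℝ _)).map (Ideal.Quotient.mkₐ ℝ (Ideal.span (Set.range F)))

noncomputable def bb (F : σ → MvPolynomial σ ℝ) (D : σ → ℕ) (s : ebox D) :
    MvPolynomial σ ℝ ⧸ Ideal.span (Set.range F) :=
  Ideal.Quotient.mkₐ ℝ (Ideal.span (Set.range F)) (monomial s.1 1)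

theorem bb_li {w D : σ → ℕ} (hD : ∀ i, 0 < D i) {F : σ → MvPolynomial σ ℝ}
    (hF : ∀ i, Lead w (F i) (single i (D i))) : LinearIndependent ℝ (bb F D) := by
  have h0 : LinearIndependent ℝ (fun s : ebox D => (monomial s.1 (1:ℝ))) := by
    have := (basisMonomials σ ℝ).linearIndependent.comp (fun s : ebox D => s.1)
      Subtype.val_injective
    simpa [Function.comp_def] using this
  refine h0.map (f := (Ideal.Quotient.mkₐ ℝ (Ideal.span (Set.range F))).toLinearMap) ?_
  rw [Submodule.disjoint_def]
  intro p hp hk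
  refine box_disjoint hD hF p ?_ ?_
  · simpa [Ideal.Quotient.eq_zero_iff_mem] using hk
  · refine (Submodule.span_le.2 ?_) hp
    rintro _ ⟨s, rfl⟩
    simpa using s.2.1

theorem bb_span {w D : σ → ℕ} {F : σ → MvPolynomial σ ℝ}
    (hF : ∀ i, Lead w (F i) (single i (D i)))
    (hτ : ∀ i, tau σ (F i) = F i ∨ tau σ (F i) = -F i) :
    Submodule.span ℝ (Set.range (bb F D)) = Subalgebra.toSubmodule (evenAlg F) := by
  apply le_antisymm
  · rw [Submodule.span_le]
    rintro _ ⟨s, rfl⟩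
    refine ⟨monomial s.1 1, ?_, rfl⟩
    change tau σ (monomial s.1 1) = monomial s.1 1
    rw [tau_mon, s.2.2.neg_one_pow, one_smul]
  · rintro _ ⟨p, hp, rfl⟩
    have hp : tau σ p = p := hp
    obtain ⟨c, hc, hpc⟩ := box_spanning hF p
    have h1 := sym_box c hc
    have h2 := add_mem hpc (tau_ideal hτ _ hpc)
    rw [map_sub, hp] at h2
    have h3 : p - (1/2 : ℝ) • (c + tau σ c) ∈ Ideal.span (Set.range F) := by
      have : p - (1/2 : ℝ) • (c + tau σ c) = C (1/2 : ℝ) * (p - c + (p - tau σ c)) := by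
        rw [← smul_eq_C_mul]
        module
      rw [this]
      exact Ideal.mul_mem_left _ _ h2
    have h4 : (Ideal.Quotient.mkₐ ℝ (Ideal.span (Set.range F))) p =
        (Ideal.Quotient.mkₐ ℝ (Ideal.span (Set.range F))) ((1/2 : ℝ) • (c + tau σ c)) :=
      Ideal.Quotient.eq.2 h3
    change (Ideal.Quotient.mkₐ ℝ (Ideal.span (Set.range F))) p ∈ _
    rw [h4]
    have h5 := Submodule.smul_mem _ (1/2 : ℝ) h1
    rw [restrictSupport_eq_span] at h5
    have h6 := Submodule.mem_map_of_mem
      (f := (Ideal.Quotient.mkₐ ℝ (Ideal.span (Set.range F))).toLinearMap) h5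
    rw [Submodule.map_span] at h6
    refine Submodule.span_mono ?_ h6
    rintro _ ⟨_, ⟨m, hm, rfl⟩, rfl⟩
    exact ⟨⟨m, hm⟩, rfl⟩

theorem algebra_zero {w D : σ → ℕ} (hD : ∀ i, 0 < D i) {F : σ → MvPolynomial σ ℝ}
    (hF : ∀ i, Lead w (F i) (single i (D i)))
    (hτ : ∀ i, tau σ (F i) = F i ∨ tau σ (F i) = -F i)
    (hfin : (ebox D).Finite) (hcard : Odd (Nat.card (ebox D)))
    (i₀ : σ) (hi₀ : F i₀ = ∑ j, X j ^ 2 - 1) :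
    ∃ y : σ → ℝ, ∀ i, eval y (F i) = 0 := by
  classical
  set I := Ideal.span (Set.range F) with hI
  have : Fintype (ebox D) := hfin.fintype
  have hspan := bb_span hF hτ
  have hfr : Module.finrank ℝ (evenAlg F) = Nat.card (ebox D) := by
    have := finrank_span_eq_card (bb_li hD hF)
    rw [hspan] at this
    rw [Nat.card_eq_fintype_card, ← this]
    rfl
  have : FiniteDimensional ℝ (evenAlg F) := by
    have : FiniteDimensional ℝ (Submodule.span ℝ (Set.range (bb F D))) :=
      FiniteDimensional.span_of_finite ℝ (Set.finite_range _)
    rw [hspan] at this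
    exact this
  obtain ⟨v, hv0, hv⟩ := common_eigenvector (ι := evenAlg F) _ (evenAlg F)
    (fun a => LinearMap.mulLeft ℝ a)
    (fun a b => by ext1 x; simp [mul_left_comm]) hfr hcard
  set x : σ → MvPolynomial σ ℝ ⧸ I := fun j => Ideal.Quotient.mkₐ ℝ I (X j) with hx
  have hxx : ∀ j k, x j * x k ∈ evenAlg F := by
    intro j k
    refine ⟨X j * X k, ?_, map_mul _ _ _⟩
    change tau σ (X j * X k) = X j * X k
    simp [tau]
  have hc : ∀ j k, ∃ c : ℝ, x j * x k * v.1 = c • v.1 := by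
    intro j k
    obtain ⟨c, hc⟩ := hv ⟨_, hxx j k⟩
    exact ⟨c, by simpa using congrArg Subtype.val hc⟩
  choose c hc using hc
  have hv1 : v.1 ≠ 0 := by simpa using hv0
  have hsum : ∑ j, x j ^ 2 = 1 := by
    have h : Ideal.Quotient.mkₐ ℝ I (F i₀) = 0 :=
      Ideal.Quotient.eq_zero_iff_mem.2 (Ideal.subset_span (Set.mem_range_self _))
    rw [hi₀, map_sub, map_sum, map_one, sub_eq_zero] at h
    simpa [hx] using h
  have hcs : ∑ j, c j j = 1 := by
    have h : (∑ j, c j j) • v.1 = (1 : ℝ) • v.1 := by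
      rw [Finset.sum_smul, one_smul]
      simp_rw [← hc]
      rw [← Finset.sum_mul]
      simp_rw [← pow_two, hsum, one_mul]
    exact smul_left_injective ℝ hv1 h
  obtain ⟨j, hj⟩ : ∃ j, 0 < c j j := by
    by_contra! h
    have := Finset.sum_nonpos (s := Finset.univ) (fun j _ => h j)
    linarith
  set s := Real.sqrt (c j j) with hs
  have hs0 : 0 < s := Real.sqrt_pos.2 hj
  have hss : s * s = c j j := Real.mul_self_sqrt hj.le
  have main : ∀ t : ℝ, t * t = c j j → x j * v.1 + t • v.1 ≠ 0 →
      ∃ y : σ → ℝ, ∀ i, eval y (F i) = 0 := by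
    intro t ht hu
    have ht0 : t ≠ 0 := by rintro rfl; simp at ht; linarith
    set u := x j * v.1 + t • v.1 with hu'
    have hxk : ∀ k, x k * u = (c j k / t) • u := by
      intro k
      have e1 : c j j • (x k * v.1) = c j k • (x j * v.1) := by
        rw [← mul_smul_comm, ← hc, ← mul_smul_comm, ← hc]; ring
      have e2 : x k * v.1 = (c j k / c j j) • (x j * v.1) := by
        rw [div_eq_inv_mul, mul_smul, ← e1, smul_smul, inv_mul_cancel₀ hj.ne', one_smul]
      have e3 : x k * (x j * v.1) = c j k • v.1 := by rw [← hc]; ring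
      rw [hu', mul_add, mul_smul_comm, e3, e2, smul_add, smul_smul, smul_smul, ← ht]
      rw [show t * (c j k / (t * t)) = c j k / t by field_simp,
        show c j k / t * t = c j k by field_simp]
      abel
    refine ⟨fun k => c j k / t, fun i => ?_⟩
    have hp : ∀ p : MvPolynomial σ ℝ, Ideal.Quotient.mkₐ ℝ I p * u =
        (eval (fun k => c j k / t) p) • u := by
      intro p
      induction p using MvPolynomial.induction_on with
      | C a =>
        have : (C a : MvPolynomial σ ℝ) = algebraMap ℝ _ a := rfl
        rw [eval_C, this, AlgHom.commutes]
        exact (Algebra.smul_def a u).symm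
      | add p q hp hq => rw [map_add, add_mul, hp, hq, map_add, add_smul]
      | mul_X p k hp =>
        rw [map_mul, mul_assoc, show Ideal.Quotient.mkₐ ℝ I (X k) = x k from rfl, hxk,
          mul_smul_comm, hp, smul_smul, map_mul, eval_X, mul_comm]
    have h := hp (F i)
    have h0 : Ideal.Quotient.mkₐ ℝ I (F i) = 0 :=
      Ideal.Quotient.eq_zero_iff_mem.2 (Ideal.subset_span (Set.mem_range_self _))
    rw [h0, zero_mul] at h
    exact (smul_eq_zero.1 h.symm).resolve_right hu
  by_cases hu : x j * v.1 + s • v.1 = 0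
  · refine main (-s) (by rw [neg_mul_neg, hss]) fun hu2 => ?_
    have : (2 * s) • v.1 = 0 := by
      have := congrArg₂ (· - ·) hu hu2
      simp only [sub_zero] at this
      rw [← this]; module
    exact hv1 ((smul_eq_zero.1 this).resolve_left (by positivity))
  · exact main s hss hu
end H
end BU
namespace BU
open MvPolynomial Finsupp

def dd (n D : ℕ) : Fin (n + 1) → ℕ := Fin.cons 2 (fun _ => D)

noncomputable def eboxEquiv (n D : ℕ) : ebox (dd n D) ≃ (Fin n → Fin D) where
  toFun m := fun i => ⟨m.1 i.succ, by simpa [dd] using m.2.1 i.succ⟩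
  invFun a := ⟨Finsupp.equivFunOnFinite.symm
      (Fin.cons ((∑ i, (a i : ℕ)) % 2) (fun i => (a i : ℕ))), by
    constructor
    · intro i
      refine Fin.cases ?_ (fun i => ?_) i
      · simpa [dd] using Nat.mod_lt (∑ i, (a i : ℕ)) (show 2 > 0 by norm_num)
      · simp [dd]
    · rw [degree_eq_sum, Fin.sum_univ_succ]
      simp only [Finsupp.equivFunOnFinite_symm_apply_apply, Fin.cons_zero, Fin.cons_succ]
      rw [Nat.even_iff]
      omega⟩
  left_inv m := by
    apply Subtype.ext
    ext i
    refine Fin.cases ?_ (fun i => ?_) i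
    · have h1 : m.1 0 < 2 := by simpa [dd] using m.2.1 0
      have h2 := m.2.2
      rw [degree_eq_sum, Fin.sum_univ_succ, Nat.even_iff] at h2
      simp only [Finsupp.equivFunOnFinite_symm_apply_apply, Fin.cons_zero]
      omega
    · simp
  right_inv a := by
    ext i
    simp

theorem odd_polys (n : ℕ) (f : Fin n → MvPolynomial (Fin (n + 1)) ℝ)
    (hf : ∀ i, tau _ (f i) = -f i) (ε : ℝ) (hε : 0 < ε) :
    ∃ y : Fin (n + 1) → ℝ, ∑ j, y j ^ 2 = 1 ∧ ∀ i, |eval y (f i)| ≤ ε := by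
  set w : Fin (n + 1) → ℕ := Fin.cons 2 (fun _ => 1) with hw
  choose k hk using fun i => exists_low w (f i)
  set D := 2 * (∑ i, k i) + 1 with hD
  have hDodd : Odd D := ⟨_, rfl⟩
  have hkD : ∀ i, k i ≤ D := fun i => by
    have := Finset.single_le_sum (f := k) (fun _ _ => Nat.zero_le _) (Finset.mem_univ i)
    omega
  set F : Fin (n + 1) → MvPolynomial (Fin (n + 1)) ℝ :=
    Fin.cons (∑ j, X j ^ 2 - 1) (fun i => X i.succ ^ D + ε⁻¹ • f i) with hFdef
  have hF0 : F 0 = ∑ j, X j ^ 2 - 1 := rfl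
  have hFs : ∀ i : Fin n, F i.succ = X i.succ ^ D + ε⁻¹ • f i := fun i => rfl
  have key : ∃ y : Fin (n + 1) → ℝ, ∀ i, eval y (F i) = 0 := by
    refine algebra_zero (w := w) (D := dd n D) (F := F) ?_ ?_ ?_ ?_ ?_ 0 hF0
    · intro i
      refine Fin.cases ?_ (fun i => ?_) i
      · simp [dd]
      · simpa [dd] using hDodd.pos
    · intro i
      refine Fin.cases ?_ (fun i => ?_) i
      · unfold Lead
        have e : F 0 - monomial (single 0 (dd n D 0)) 1 =
            ∑ j : Fin n, monomial (single j.succ 2) 1 - monomial 0 1 := by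
          rw [hF0, Fin.sum_univ_succ]
          simp only [dd, Fin.cons_zero, X_pow_eq_monomial, ← C_apply, map_one]
          ring
        have e4 : weight w (single 0 (dd n D 0)) = 4 := by simp [weight_single, hw, dd]
        rw [e, e4]
        refine sub_mem (Submodule.sum_mem _ fun j _ => ?_) ?_
        · refine (monomial_mem_restrictSupport ℝ).2 (Or.inl ?_)
          simp [weight_single, hw]
        · refine (monomial_mem_restrictSupport ℝ).2 (Or.inl ?_)
          simp
      · unfold Lead
        have e4 : weight w (single i.succ (dd n D i.succ)) = D := by
          simp [weight_single, hw, dd]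
        have e : F i.succ - monomial (single i.succ (dd n D i.succ)) 1 = ε⁻¹ • f i := by
          rw [hFs, X_pow_eq_monomial]
          simp [dd]
        rw [e, e4]
        exact Submodule.smul_mem _ _ (low_mono (hkD i) (hk i))
    · intro i
      refine Fin.cases ?_ (fun i => ?_) i
      · left
        rw [hF0]
        simp [tau]
      · right
        rw [hFs, map_add, map_smul, hf]
        simp only [tau, map_pow, aeval_X, hDodd.neg_pow]
        rw [smul_neg, neg_add]
    · have : Finite (ebox (dd n D)) := Finite.of_equiv _ (eboxEquiv n D).symm
      exact Set.toFinite _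
    · rw [Nat.card_congr (eboxEquiv n D)]
      simpa using hDodd.pow
  obtain ⟨y, hy⟩ := key
  have hy0 : ∑ j, y j ^ 2 = 1 := by
    have := hy 0
    rw [hF0] at this
    simp only [map_sub, map_sum, map_pow, eval_X, map_one] at this
    linarith
  refine ⟨y, hy0, fun i => ?_⟩
  have h := hy i.succ
  rw [hFs] at h
  simp only [map_add, map_pow, eval_X, smul_eval] at h
  have h1 : |y i.succ| ≤ 1 := by
    rw [← sq_le_one_iff_abs_le_one, ← hy0]
    exact Finset.single_le_sum (f := fun j => y j ^ 2) (fun _ _ => sq_nonneg _)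
      (Finset.mem_univ _)
  have h2 : eval y (f i) = -(ε * y i.succ ^ D) := by
    field_simp at h
    linarith
  rw [h2, abs_neg, abs_mul, abs_of_pos hε, abs_pow]
  exact mul_le_of_le_one_right hε.le (pow_le_one₀ (abs_nonneg _) h1)

theorem borsuk (n : ℕ) (hn : 0 < n)
    (f : C(Metric.sphere (0 : EuclideanSpace ℝ (Fin (n + 1))) 1, EuclideanSpace ℝ (Fin n)))
    (hf : ∀ x y : Metric.sphere (0 : EuclideanSpace ℝ (Fin (n + 1))) 1,
      y.1 = -x.1 → f y = -f x) : ∃ x, f x = 0 := by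
  by_contra! hne
  set g : Metric.sphere (0 : EuclideanSpace ℝ (Fin (n + 1))) 1 → ℝ := fun x => ∑ i, |f x i|
    with hg
  have hgc : Continuous g := by fun_prop
  have hcs : CompactSpace (Metric.sphere (0 : EuclideanSpace ℝ (Fin (n + 1))) 1) :=
    isCompact_iff_compactSpace.1 (isCompact_sphere _ _)
  have hns : Nonempty (Metric.sphere (0 : EuclideanSpace ℝ (Fin (n + 1))) 1) :=
    (NormedSpace.sphere_nonempty.2 zero_le_one).to_subtype
  obtain ⟨x₀, -, hx₀⟩ := isCompact_univ.exists_isMinOn Set.univ_nonempty hgc.continuousOn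
  have hmin : ∀ x, g x₀ ≤ g x := fun x => hx₀ (Set.mem_univ x)
  have hδ : 0 < g x₀ := by
    refine lt_of_le_of_ne (Finset.sum_nonneg fun _ _ => abs_nonneg _) fun h => hne x₀ ?_
    have := (Finset.sum_eq_zero_iff_of_nonneg (fun _ _ => abs_nonneg _)).1 h.symm
    ext i
    simpa using this i (Finset.mem_univ i)
  set η := g x₀ / (4 * n) with hη
  have hn' : (0:ℝ) < n := by exact_mod_cast hn
  have hη0 : 0 < η := by positivity
  let co : Fin (n + 1) → C(Metric.sphere (0 : EuclideanSpace ℝ (Fin (n + 1))) 1, ℝ) :=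
    fun i => ⟨fun x => x.1 i, by fun_prop⟩
  have hsep : ((aeval co : MvPolynomial (Fin (n + 1)) ℝ →ₐ[ℝ] _).range).SeparatesPoints := by
    intro x y hxy
    have : ∃ i, x.1 i ≠ y.1 i := by
      by_contra! h
      exact hxy (Subtype.ext (by ext i; exact h i))
    obtain ⟨i, hi⟩ := this
    exact ⟨_, ⟨co i, ⟨X i, by simp⟩, rfl⟩, hi⟩
  have hev : ∀ (p : MvPolynomial (Fin (n + 1)) ℝ) x,
      (aeval co p : C(Metric.sphere (0 : EuclideanSpace ℝ (Fin (n + 1))) 1, ℝ)) x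
        = eval (fun i => x.1 i) p := by
    intro p x
    induction p using MvPolynomial.induction_on with
    | C a => simp
    | add p q hp hq => simp [hp, hq]
    | mul_X p k hp => simp [hp, co]
  have happ : ∀ i, ∃ p : MvPolynomial (Fin (n + 1)) ℝ,
      ∀ x : Metric.sphere (0 : EuclideanSpace ℝ (Fin (n + 1))) 1,
        |eval (fun j => x.1 j) p - f x i| < η := by
    intro i
    obtain ⟨⟨q, ⟨p, rfl⟩⟩, hq⟩ :=
      ContinuousMap.exists_mem_subalgebra_near_continuous_of_separatesPoints
      _ hsep (fun x => f x i) (by fun_prop) η hη0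
    refine ⟨p, fun x => ?_⟩
    have := hq x
    rw [← hev]
    simpa using this
  choose p hp using happ
  have htau : ∀ (q : MvPolynomial (Fin (n + 1)) ℝ) (y : Fin (n + 1) → ℝ),
      eval y (tau _ q) = eval (fun j => -y j) q := by
    intro q y
    induction q using MvPolynomial.induction_on with
    | C a => simp [tau]
    | add p q hp hq => simp [hp, hq]
    | mul_X p k hp => rw [map_mul, map_mul, hp]; simp [tau]
  have htt : ∀ q : MvPolynomial (Fin (n + 1)) ℝ, tau _ (tau _ q) = q := by
    intro q
    induction q using MvPolynomial.induction_on with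
    | C a => simp [tau]
    | add p q hp hq => simp [hp, hq]
    | mul_X p k hp => rw [map_mul, map_mul, hp]; simp [tau]
  obtain ⟨y, hy1, hy⟩ := odd_polys n (fun i => (1/2 : ℝ) • (p i - tau _ (p i)))
    (fun i => by rw [map_smul, map_sub, htt]; module) η hη0
  let x : Metric.sphere (0 : EuclideanSpace ℝ (Fin (n + 1))) 1 :=
    ⟨WithLp.toLp 2 y, by simp [EuclideanSpace.norm_eq, hy1]⟩
  let x' : Metric.sphere (0 : EuclideanSpace ℝ (Fin (n + 1))) 1 :=
    ⟨-WithLp.toLp 2 y, by simp [EuclideanSpace.norm_eq, hy1]⟩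
  have hb : ∀ i, |f x i| ≤ 2 * η := by
    intro i
    have h1 := hp i x
    have h2 := hp i x'
    have h3 := hy i
    rw [hf x x' rfl] at h2
    simp only [smul_eval, map_sub, htau] at h3
    simp only [x, x', PiLp.neg_apply, abs_lt] at h1 h2
    rw [abs_le] at h3 ⊢
    constructor <;> linarith [h1.1, h1.2, h2.1, h2.2, h3.1, h3.2]
  have h1 : g x ≤ ∑ _i : Fin n, 2 * η := Finset.sum_le_sum fun i _ => hb i
  have h2 : ∑ _i : Fin n, 2 * η = g x₀ / 2 := by
    simp [hη]; field_simp; norm_num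
  have := hmin x
  linarith
end BU

/-- **Borsuk–Ulam form.** There is no continuous ℤ₂-equivariant map
from `S^{k+1}` to `ℝ^{k+1} \ {0}`: every continuous antipodal map
`S^{k+1} → ℝ^{k+1}` has a zero. -/
theorem no_equivariant_map_sphere_to_punctured
    (k : ℕ)
    (f : C(Metric.sphere (0 : EuclideanSpace ℝ (Fin (k + 2))) 1,
          EuclideanSpace ℝ (Fin (k + 1))))
    (hf : ∀ x : Metric.sphere (0 : EuclideanSpace ℝ (Fin (k + 2))) 1,
      f ⟨-x.1, by simp [x.2]⟩ = -f x) :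
    ∃ x, f x = 0 := by
  exact BU.borsuk (k + 1) k.succ_pos f fun x y h => by
    rw [← hf x]; congr 1; exact Subtype.ext h
end

section
/- Colorful Hadwiger-type theorem via partition matroids (special case of main theorem): Let F = F₁ ∪ ⋯ ∪ F_{k+2} be a finite family of convex sets in ℝ^d partitioned into k+2 nonempty color classes, with 0 ≤ k < d. Suppose there is a map φ : F → ℝ^k such that for every colorful (k+2)-tuple {A₁,…,A_{k+2}} (one set from each class) and every partition into two parts G₁, G₂: if conv G₁ ∩ conv G₂ = ∅ then conv φ(G₁) ∩ conv φ(G₂) = ∅. Then some color class F_i has a hyperplane transversal. -/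
open RealInnerProductSpace
namespace CH

abbrev Lab (n : ℕ) := Fin n × Bool

def sg (b : Bool) : ℤ := if b then 1 else -1

lemma sg_cases (b : Bool) : sg b = 1 ∨ sg b = -1 := by cases b <;> simp [sg]

lemma sg_not (b : Bool) : sg (!b) = - sg b := by cases b <;> simp [sg]

def nl {n : ℕ} (a : Lab n) : Lab n := (a.1, !a.2)

lemma nl_nl {n : ℕ} (a : Lab n) : nl (nl a) = a := by simp [nl]

lemma nl_ne {n : ℕ} (a : Lab n) : nl a ≠ a := by
  intro h
  have := congrArg Prod.snd h
  simp [nl] at this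

def stp {n : ℕ} (a : Lab n) : Fin n → ℤ := Pi.single a.1 (sg a.2)

lemma stp_nl {n : ℕ} (a : Lab n) : stp (nl a) = - stp a := by
  simp [stp, nl, sg_not, Pi.single_neg]

lemma stp_same {n : ℕ} (a : Lab n) : stp a a.1 = sg a.2 := by simp [stp]

lemma stp_other {n : ℕ} (a : Lab n) (i : Fin n) (h : i ≠ a.1) : stp a i = 0 := by
  simp [stp, h]

def verts {n : ℕ} : (Fin n → ℤ) → List (Lab n) → List (Fin n → ℤ)
  | v, [] => [v]
  | v, a :: l => v :: verts (v + stp a) l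

lemma verts_length {n : ℕ} (l : List (Lab n)) (v : Fin n → ℤ) :
    (verts v l).length = l.length + 1 := by
  induction l generalizing v with
  | nil => rfl
  | cons a l ih => simp [verts, ih]

lemma verts_append {n : ℕ} (l : List (Lab n)) (a : Lab n) (v : Fin n → ℤ) :
    ∃ w, verts v (l ++ [a]) = verts v l ++ [w] := by
  induction l generalizing v with
  | nil => exact ⟨v + stp a, rfl⟩
  | cons b l ih =>
    obtain ⟨w, hw⟩ := ih (v + stp b)
    exact ⟨w, by simp [verts, hw]⟩

lemma verts_erase_last {n : ℕ} (l : List (Lab n)) (a : Lab n) (v : Fin n → ℤ) :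
    (verts v (l ++ [a])).eraseIdx (l.length + 1) = verts v l := by
  obtain ⟨w, hw⟩ := verts_append l a v
  rw [hw, List.eraseIdx_append_of_length_le (by simp [verts_length]), verts_length]
  simp

lemma verts_neg {n : ℕ} (l : List (Lab n)) (v : Fin n → ℤ) :
    verts (-v) (l.map nl) = (verts v l).map (fun p => -p) := by
  induction l generalizing v with
  | nil => rfl
  | cons a l ih =>
    simp only [verts, List.map_cons, stp_nl]
    rw [← ih]
    congr 2
    abel

def swapAt {α : Type*} : List α → ℕ → List α
  | a :: b :: l, 0 => b :: a :: l
  | a :: l, j + 1 => a :: swapAt l j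
  | l, _ => l

lemma swapAt_perm {α : Type*} (l : List α) (j : ℕ) : (swapAt l j).Perm l := by
  induction l generalizing j with
  | nil => cases j <;> simp [swapAt]
  | cons a l ih =>
    cases j with
    | zero =>
      cases l with
      | nil => simp [swapAt]
      | cons b l => simpa [swapAt] using List.Perm.swap a b l
    | succ j => simpa [swapAt] using ih j

lemma swapAt_swapAt {α : Type*} (l : List α) (j : ℕ) : swapAt (swapAt l j) j = l := by
  induction l generalizing j with
  | nil => cases j <;> simp [swapAt]
  | cons a l ih =>
    cases j with
    | zero =>
      cases l with
      | nil => simp [swapAt]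
      | cons b l => simp [swapAt]
    | succ j => simpa [swapAt] using ih j

lemma swapAt_ne {α : Type*} (l : List α) (hl : l.Nodup) (j : ℕ) (hj : j + 1 < l.length) :
    swapAt l j ≠ l := by
  induction l generalizing j with
  | nil => simp at hj
  | cons a l ih =>
    cases j with
    | zero =>
      cases l with
      | nil => simp at hj
      | cons b l =>
        intro h
        simp [swapAt] at h
        simp [h.1] at hl
    | succ j =>
      intro h
      simp [swapAt] at h
      exact ih (List.nodup_cons.1 hl).2 j (by simpa using hj) h

lemma verts_swapAt {n : ℕ} (l : List (Lab n)) (j : ℕ) (hj : j + 1 < l.length) (v : Fin n → ℤ) :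
    (verts v (swapAt l j)).eraseIdx (j + 1) = (verts v l).eraseIdx (j + 1) := by
  induction l generalizing j v with
  | nil => simp at hj
  | cons a l ih =>
    cases j with
    | zero =>
      cases l with
      | nil => simp at hj
      | cons b l =>
        simp [swapAt, verts, add_right_comm]
    | succ j =>
      have := ih j (by simpa using hj) (v + stp a)
      simp [swapAt, verts, this]

lemma mem_verts {n : ℕ} (l : List (Lab n)) (hl : (l.map Prod.fst).Nodup) (v p : Fin n → ℤ)
    (hp : p ∈ verts v l) (i : Fin n) :
    p i = v i ∨ ∃ a ∈ l, a.1 = i ∧ p i = v i + sg a.2 := by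
  induction l generalizing v with
  | nil => simp [verts] at hp; simp [hp]
  | cons b l ih =>
    simp only [verts, List.mem_cons] at hp
    rw [List.map_cons, List.nodup_cons] at hl
    rcases hp with rfl | hp
    · simp
    · rcases ih hl.2 _ hp with h | ⟨a, ha, hai, h⟩
      · by_cases hb : i = b.1
        · right
          refine ⟨b, by simp, hb.symm, ?_⟩
          subst hb
          rw [h, Pi.add_apply, stp_same]
        · left
          rw [h, Pi.add_apply, stp_other _ _ hb, add_zero]
      · right
        refine ⟨a, by simp [ha], hai, ?_⟩
        have hb : i ≠ b.1 := by
          rintro rfl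
          apply hl.1
          rw [← hai]
          exact List.mem_map_of_mem ha
        rw [h, Pi.add_apply, stp_other _ _ hb, add_zero]

def Valid {n : ℕ} (N : ℤ) (v : Fin n → ℤ) (l : List (Lab n)) : Prop :=
  (l.map Prod.fst).Nodup ∧ (∀ a ∈ l, 0 ≤ sg a.2 * v a.1 ∧ sg a.2 * v a.1 < N) ∧
    ∀ i, (∀ a ∈ l, a.1 ≠ i) → v i = 0

lemma Valid.bound {n : ℕ} {N : ℤ} (hN : 0 < N) {v : Fin n → ℤ} {l : List (Lab n)}
    (h : Valid N v l) {p : Fin n → ℤ} (hp : p ∈ verts v l) (i : Fin n) : |p i| ≤ N := by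
  rw [abs_le]
  by_cases hi : ∀ a ∈ l, a.1 ≠ i
  · rcases mem_verts l h.1 v p hp i with h1 | ⟨a, ha, hai, h1⟩
    · rw [h1, h.2.2 i hi]; constructor <;> omega
    · exact absurd hai (hi a ha)
  · push Not at hi
    obtain ⟨b, hb, rfl⟩ := hi
    have hb2 := h.2.1 b hb
    rcases mem_verts l h.1 v p hp b.1 with h1 | ⟨a, ha, hai, h1⟩
    · rw [h1]
      rcases sg_cases b.2 with e | e <;> rw [e] at hb2 <;> constructor <;> omega
    · have : a = b := List.inj_on_of_nodup_map h.1 ha hb hai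
      subst this
      rw [h1]
      rcases sg_cases a.2 with e | e <;> rw [e] at hb2 ⊢ <;> constructor <;> omega

lemma verts_close {n : ℕ} {l : List (Lab n)} (hl : (l.map Prod.fst).Nodup) {v p q : Fin n → ℤ}
    (hp : p ∈ verts v l) (hq : q ∈ verts v l) (i : Fin n) : |p i - q i| ≤ 1 := by
  rw [abs_le]
  rcases mem_verts l hl v p hp i with h1 | ⟨a, ha, hai, h1⟩ <;>
  rcases mem_verts l hl v q hq i with h2 | ⟨b, hb, hbi, h2⟩
  · rw [h1, h2]; constructor <;> omega
  · rw [h1, h2]; rcases sg_cases b.2 with e | e <;> rw [e] <;> constructor <;> omega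
  · rw [h1, h2]; rcases sg_cases a.2 with e | e <;> rw [e] <;> constructor <;> omega
  · have : a = b := List.inj_on_of_nodup_map hl ha hb (hai.trans hbi.symm)
    subst this
    rw [h1, h2]; constructor <;> omega

lemma Valid.perm {n : ℕ} {N : ℤ} {v : Fin n → ℤ} {l l' : List (Lab n)}
    (h : Valid N v l) (hp : l'.Perm l) : Valid N v l' := by
  refine ⟨(hp.map _).nodup_iff.2 h.1, fun a ha => h.2.1 a (hp.mem_iff.1 ha),
    fun i hi => h.2.2 i fun a ha => hi a (hp.mem_iff.2 ha)⟩

lemma valid_nil {n : ℕ} {N : ℤ} {v : Fin n → ℤ} : Valid N v [] ↔ v = 0 := by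
  simp [Valid, funext_iff]

lemma Valid.neg {n : ℕ} {N : ℤ} {v : Fin n → ℤ} {l : List (Lab n)}
    (h : Valid N v l) : Valid N (-v) (l.map nl) := by
  refine ⟨?_, ?_, ?_⟩
  · have : (l.map nl).map Prod.fst = l.map Prod.fst := by simp [nl]
    rw [this]; exact h.1
  · intro a ha
    obtain ⟨b, hb, rfl⟩ := List.mem_map.1 ha
    have := h.2.1 b hb
    simpa [nl, sg_not] using this
  · intro i hi
    have := h.2.2 i fun a ha => by
      have := hi (nl a) (List.mem_map_of_mem ha)
      simpa [nl] using this
    simp [this]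

/-- pushing a zero coordinate -/
lemma valid_snoc {n : ℕ} {N : ℤ} (hN : 0 < N) {v : Fin n → ℤ} {l : List (Lab n)} {a : Lab n}
    (ha : ∀ b ∈ l, b.1 ≠ a.1) :
    (Valid N v (l ++ [a]) ∧ v a.1 = 0) ↔ Valid N v l := by
  constructor
  · rintro ⟨h, h0⟩
    refine ⟨?_, fun b hb => h.2.1 b (by simp [hb]), ?_⟩
    · have := h.1
      rw [List.map_append] at this
      exact this.of_append_left
    · intro i hi
      by_cases hia : a.1 = i
      · rw [← hia, h0]
      · apply h.2.2 i
        intro b hb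
        rcases List.mem_append.1 hb with hb | hb
        · exact hi b hb
        · simp at hb; rw [hb]; exact hia
  · intro h
    have h0 := h.2.2 a.1 ha
    refine ⟨⟨?_, ?_, ?_⟩, h0⟩
    · rw [List.map_append, List.nodup_append]
      refine ⟨h.1, by simp, ?_⟩
      intro x hx y hy
      obtain ⟨b, hb, rfl⟩ := List.mem_map.1 hx
      simp at hy
      rw [hy]; exact ha b hb
    · intro b hb
      rcases List.mem_append.1 hb with hb | hb
      · exact h.2.1 b hb
      · simp at hb; rw [hb, h0]; simp [hN]
    · intro i hi
      exact h.2.2 i fun b hb => hi b (by simp [hb])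

open Classical in
/-- count of the facets with a prescribed label set -/
lemma erase_count {α : Type*} [DecidableEq α] (L l : List α) (hl : l.Nodup)
    (hlen : L.length = l.length + 1) :
    ((((Finset.range (l.length + 1)).filter (fun j => (L.eraseIdx j).Perm l)).card : ℕ) : ZMod 2)
      = if ∃ x, x ∉ l ∧ L.Perm (x :: l) then 1 else 0 := by
  by_cases h : ∃ x, L.Perm (x :: l)
  · obtain ⟨x, hx⟩ := h
    have key : ∀ j ∈ Finset.range (l.length + 1),
        ((L.eraseIdx j).Perm l ↔ L[j]? = some x) := by
      intro j hj
      have hj' : j < L.length := by rw [hlen]; simpa using hj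
      have hp : (L[j] :: L.eraseIdx j).Perm L := List.getElem_cons_eraseIdx_perm hj'
      rw [List.getElem?_eq_getElem hj', Option.some_inj]
      constructor
      · intro h1
        have h2 : (L[j] :: l).Perm (x :: l) := ((h1.cons _).symm.trans hp).trans hx
        by_contra hne
        have h3 := h2.count_eq x
        rw [List.count_cons_self, List.count_cons_of_ne hne] at h3
        omega
      · intro h1
        rw [h1] at hp
        exact (List.perm_cons x).1 (hp.trans hx)
    have hc : ((Finset.range (l.length + 1)).filter (fun j => (L.eraseIdx j).Perm l)).card
        = L.count x := by
      rw [Finset.filter_congr key, ← hlen]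
      clear key hx hlen
      induction L using List.reverseRecOn with
      | nil => simp
      | append_singleton L y ih =>
        rw [List.length_append, List.length_singleton, Finset.range_add_one, Finset.filter_insert,
          List.count_append]
        have h1 : (Finset.range L.length).filter (fun j => (L ++ [y])[j]? = some x)
            = (Finset.range L.length).filter (fun j => L[j]? = some x) := by
          apply Finset.filter_congr
          intro j hj
          rw [List.getElem?_append_left (by simpa using hj)]
        rw [h1]
        by_cases hy : y = x
        · simp [hy, ih]
        · simp [hy, ih]
    rw [hc, hx.count_eq, List.count_cons_self]
    by_cases hxl : x ∈ l
    · have hno : ¬ ∃ y, y ∉ l ∧ L.Perm (y :: l) := by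
        rintro ⟨y, hy, hL⟩
        have h3 := (hx.symm.trans hL).count_eq y
        have hne : x ≠ y := by rintro rfl; exact hy hxl
        rw [List.count_cons_self, List.count_cons_of_ne hne] at h3
        omega
      rw [if_neg hno, List.count_eq_one_of_mem hl hxl]
      rfl
    · rw [if_pos ⟨x, hxl, hx⟩, List.count_eq_zero_of_not_mem hxl]
      simp
  · rw [if_neg (fun ⟨x, _, hx⟩ => h ⟨x, hx⟩), Finset.filter_false_of_mem]
    · simp
    · intro j hj h1
      have hj' : j < L.length := by rw [hlen]; simpa using hj
      have hp : (L[j] :: L.eraseIdx j).Perm L := List.getElem_cons_eraseIdx_perm hj'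
      exact h ⟨L[j], hp.symm.trans (h1.cons _)⟩

end CH

namespace CH

lemma even_of_invol {α : Type*} (s : Finset α) (g : α → α) (hg : ∀ a ∈ s, g a ∈ s)
    (hne : ∀ a ∈ s, g a ≠ a) (hgg : ∀ a ∈ s, g (g a) = a) : ((s.card : ℕ) : ZMod 2) = 0 := by
  have h : ∑ a ∈ s, (1 : ZMod 2) = 0 :=
    Finset.sum_involution (fun a _ => g a) (fun _ _ => by decide) (fun a ha _ => hne a ha)
      hg hgg
  simpa using h

lemma finite_valid {n : ℕ} {N : ℤ} (hN : 0 < N) :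
    {x : (Fin n → ℤ) × List (Lab n) | Valid N x.1 x.2}.Finite := by
  have h1 : (Set.Icc (fun _ : Fin n => -N) (fun _ => N)).Finite := Set.finite_Icc _ _
  have h2 := List.finite_length_le (Lab n) n
  refine (h1.prod h2).subset ?_
  rintro ⟨v, l⟩ h
  have hv : v ∈ verts v l := by cases l <;> simp [verts]
  refine ⟨⟨fun i => (abs_le.1 (h.bound hN hv i)).1, fun i => (abs_le.1 (h.bound hN hv i)).2⟩, ?_⟩
  have := h.1.length_le_card
  simpa using this

lemma nodup_of_fst {n : ℕ} {l : List (Lab n)} (h : (l.map Prod.fst).Nodup) : l.Nodup :=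
  List.Nodup.of_map _ h

open Classical in
theorem tucker {n : ℕ} {N : ℤ} (hN : 0 < N) (lam : (Fin n → ℤ) → Lab n)
    (hodd : ∀ p, (∀ i, |p i| ≤ N) → (∃ i, |p i| = N) → lam (-p) = nl (lam p)) :
    ∃ p q, (∀ i, |p i| ≤ N) ∧ (∀ i, |q i| ≤ N) ∧ (∀ i, |p i - q i| ≤ 1) ∧ lam q = nl (lam p) := by
  by_contra hcon
  have hcomp : ∀ v l, Valid N v l → ∀ p ∈ verts v l, ∀ q ∈ verts v l, lam q ≠ nl (lam p) := by
    intro v l h p hp q hq he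
    exact hcon ⟨p, q, h.bound hN hp, h.bound hN hq, verts_close h.1 hp hq, he⟩
  clear hcon
  set V := (finite_valid (n := n) hN).toFinset with hV
  have memV : ∀ v l, (v, l) ∈ V ↔ Valid N v l := by intro v l; simp [hV]
  let P : ((Fin n → ℤ) × List (Lab n)) → ℕ → Prop := fun x j =>
    (((verts x.1 x.2).map lam).eraseIdx j).Perm x.2
  let Q : ((Fin n → ℤ) × List (Lab n)) → Prop := fun x =>
    ∃ y, y ∉ x.2 ∧ ((verts x.1 x.2).map lam).Perm (y :: x.2)
  -- doors
  let Om : Finset (((Fin n → ℤ) × List (Lab n)) × ℕ) :=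
    (V ×ˢ Finset.range (n + 1)).filter (fun z => z.1.2 ≠ [] ∧ z.2 ≤ z.1.2.length ∧ P z.1 z.2)
  have memOm : ∀ v l j, ((v, l), j) ∈ Om ↔ Valid N v l ∧ l ≠ [] ∧ j ≤ l.length ∧
      (((verts v l).map lam).eraseIdx j).Perm l := by
    intro v l j
    simp only [Om, P, Finset.mem_filter, Finset.mem_product, memV, Finset.mem_range]
    constructor
    · rintro ⟨⟨h1, h2⟩, h3, h4, h5⟩; exact ⟨h1, h3, h4, h5⟩
    · rintro ⟨h1, h3, h4, h5⟩
      have := h1.1.length_le_card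
      simp at this
      exact ⟨⟨h1, by omega⟩, h3, h4, h5⟩
  have hR1 : ((Om.card : ℕ) : ZMod 2) = ((V.filter (fun x => x.2 ≠ [] ∧ Q x)).card : ℕ) := by
    have : Om.card = ∑ x ∈ V.filter (fun x => x.2 ≠ []),
        ((Finset.range (x.2.length + 1)).filter (fun j => P x j)).card := by
      rw [← Finset.card_sigma]
      refine Finset.card_bij (fun z _ => ⟨z.1, z.2⟩) ?_ ?_ ?_
      · rintro ⟨⟨v, l⟩, j⟩ hz
        obtain ⟨h1, h2, h3, h4⟩ := (memOm _ _ _).1 hz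
        simp only [Finset.mem_sigma, Finset.mem_filter, memV, Finset.mem_range]
        exact ⟨⟨h1, h2⟩, by omega, h4⟩
      · rintro ⟨x, j⟩ _ ⟨x', j'⟩ _ h
        simpa using h
      · rintro ⟨⟨v, l⟩, j⟩ hz
        simp only [Finset.mem_sigma, Finset.mem_filter, memV, Finset.mem_range] at hz
        exact ⟨((v, l), j), (memOm _ _ _).2 ⟨hz.1.1, hz.1.2, by omega, hz.2.2⟩, rfl⟩
    rw [this, ← Finset.filter_filter, Finset.card_filter, Nat.cast_sum, Nat.cast_sum]
    apply Finset.sum_congr rfl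
    rintro ⟨v, l⟩ hx
    rw [Finset.mem_filter, memV] at hx
    have := erase_count ((verts v l).map lam) l (nodup_of_fst hx.1.1)
      (by rw [List.length_map, verts_length])
    rw [Nat.cast_ite, Nat.cast_one, Nat.cast_zero]
    convert this using 2
  have hR0 : (V.filter Q).card = (V.filter (fun x => x.2 ≠ [] ∧ Q x)).card + 1 := by
    have : V.filter Q = insert ((0 : Fin n → ℤ), []) (V.filter (fun x => x.2 ≠ [] ∧ Q x)) := by
      ext ⟨v, l⟩
      simp only [Finset.mem_filter, Finset.mem_insert, memV, Prod.mk.injEq]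
      constructor
      · rintro ⟨h1, h2⟩
        by_cases hl : l = []
        · subst hl; left; exact ⟨valid_nil.1 h1, rfl⟩
        · right; exact ⟨h1, hl, h2⟩
      · rintro (⟨rfl, rfl⟩ | ⟨h1, h2, h3⟩)
        · refine ⟨valid_nil.2 rfl, lam 0, by simp, by simp [verts]⟩
        · exact ⟨h1, h3⟩
    rw [this, Finset.card_insert_of_notMem (by simp)]
  -- split the doors
  have hmid : (((Om.filter (fun z => 0 < z.2 ∧ z.2 < z.1.2.length)).card : ℕ) : ZMod 2) = 0 := by
    apply even_of_invol _ (fun z => ((z.1.1, swapAt z.1.2 (z.2 - 1)), z.2))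
    · rintro ⟨⟨v, l⟩, j⟩ hz
      simp only [Finset.mem_filter, memOm] at hz ⊢
      obtain ⟨⟨h1, h2, h3, h4⟩, h5, h6⟩ := hz
      obtain ⟨j, rfl⟩ : ∃ i, j = i + 1 := ⟨j - 1, by omega⟩
      have hp := swapAt_perm l j
      simp only [Nat.add_sub_cancel]
      refine ⟨⟨h1.perm hp, ?_, ?_, ?_⟩, h5, ?_⟩
      · intro h; rw [h] at hp; exact h2 hp.nil_eq.symm
      · rw [hp.length_eq]; exact h3
      · rw [List.eraseIdx_map, verts_swapAt l j h6, ← List.eraseIdx_map]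
        exact h4.trans hp.symm
      · rw [hp.length_eq]; exact h6
    · rintro ⟨⟨v, l⟩, j⟩ hz
      simp only [Finset.mem_filter, memOm] at hz
      obtain ⟨⟨h1, h2, h3, h4⟩, h5, h6⟩ := hz
      intro he
      simp only [Prod.mk.injEq, true_and, and_true] at he
      exact swapAt_ne l (nodup_of_fst h1.1) (j - 1) (by omega) he
    · rintro ⟨⟨v, l⟩, j⟩ hz
      simp [swapAt_swapAt]
  let hd : ((Fin n → ℤ) × List (Lab n)) → Prop := fun x =>
    ∃ a l', x.2 = a :: l' ∧ sg a.2 * x.1 a.1 + 1 = N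
  let tl : ((Fin n → ℤ) × List (Lab n)) → Prop := fun x =>
    ∃ a l', x.2 = l' ++ [a] ∧ x.1 a.1 = 0
  have hbd : (((Om.filter (fun z => z.2 = 0 ∧ hd z.1)).card : ℕ) : ZMod 2) = 0 := by
    apply even_of_invol _ (fun z => ((-z.1.1, z.1.2.map nl), z.2))
    · rintro ⟨⟨v, l⟩, j⟩ hz
      simp only [Finset.mem_filter, memOm, hd] at hz ⊢
      obtain ⟨⟨h1, h2, h3, h4⟩, rfl, a, l, rfl, h5⟩ := hz
      refine ⟨⟨h1.neg, by simp, by simp, ?_⟩, rfl, nl a, l.map nl, by simp, ?_⟩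
      · rw [verts_neg]
        have e1 : ((verts v (a :: l)).map lam).eraseIdx 0 = (verts (v + stp a) l).map lam := by
          simp [verts]
        have e2 : (((verts v (a :: l)).map (fun p => -p)).map lam).eraseIdx 0
            = ((verts (v + stp a) l).map lam).map nl := by
          simp only [verts, List.map_cons, List.eraseIdx_cons_zero, List.map_map]
          apply List.map_congr_left
          intro p hp
          have hnd := h1.1
          rw [List.map_cons, List.nodup_cons] at hnd
          have hp' : p ∈ verts v (a :: l) := by simp [verts, hp]
          apply hodd p (h1.bound hN hp')
          refine ⟨a.1, ?_⟩
          have hpa : p a.1 = v a.1 + sg a.2 := by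
            rcases mem_verts l hnd.2 _ p hp a.1 with h | ⟨b, hb, hba, _⟩
            · rw [h, Pi.add_apply, stp_same]
            · exfalso; apply hnd.1; rw [← hba]; exact List.mem_map_of_mem hb
          rw [hpa]
          rcases sg_cases a.2 with e | e <;> rw [e] at h5 ⊢
          · rw [abs_of_nonneg] <;> omega
          · rw [abs_of_nonpos] <;> omega
        rw [e2]
        rw [e1] at h4
        exact h4.map nl
      · simpa [nl, sg_not] using h5
    · rintro ⟨⟨v, l⟩, j⟩ hz
      simp only [Finset.mem_filter, memOm, hd] at hz
      obtain ⟨⟨h1, h2, h3, h4⟩, rfl, a, l, rfl, h5⟩ := hz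
      intro he
      simp only [Prod.mk.injEq, List.map_cons, List.cons.injEq] at he
      exact nl_ne a he.1.2.1
    · rintro ⟨⟨v, l⟩, j⟩ hz
      have : (nl ∘ nl : Lab n → Lab n) = id := funext nl_nl
      simp [this]
  have hZ : (Om.filter (fun z => z.2 = 0 ∧ ¬ hd z.1)).card
      = (Om.filter (fun z => z.2 = z.1.2.length ∧ ¬ tl z.1)).card := by
    refine Finset.card_bij (fun z _ => match z with
      | ((v, []), j) => ((v, []), j)
      | ((v, a :: l), j) => ((v + stp a, l ++ [a]), l.length + 1)) ?_ ?_ ?_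
    · rintro ⟨⟨v, _ | ⟨a, l⟩⟩, j⟩ hz
      · simp [memOm] at hz
      · simp only [Finset.mem_filter, memOm, hd, tl] at hz ⊢
        obtain ⟨⟨h1, h2, h3, h4⟩, rfl, h5⟩ := hz
        have h6 : sg a.2 * v a.1 + 1 ≠ N := fun h => h5 ⟨a, l, rfl, h⟩
        have ha := h1.2.1 a (by simp)
        have hnd := h1.1
        rw [List.map_cons, List.nodup_cons] at hnd
        have hpm : (l ++ [a]).Perm (a :: l) := List.perm_append_singleton a l
        refine ⟨⟨⟨(h1.perm hpm).1, ?_, ?_⟩, by simp, by simp, ?_⟩, by simp, ?_⟩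
        · intro b hb
          by_cases hba : b.1 = a.1
          · have : b = a := List.inj_on_of_nodup_map h1.1 (hpm.mem_iff.1 hb) (by simp) hba
            rw [this, Pi.add_apply, stp_same]
            rcases sg_cases a.2 with e | e <;> rw [e] at ha h6 ⊢ <;> constructor <;> omega
          · rw [Pi.add_apply, stp_other _ _ hba, add_zero]
            exact h1.2.1 b (hpm.mem_iff.1 hb)
        · intro i hi
          have hia : i ≠ a.1 := fun h => hi a (by simp) h.symm
          rw [Pi.add_apply, stp_other _ _ hia, add_zero]
          exact h1.2.2 i fun b hb => hi b (hpm.mem_iff.2 hb)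
        · rw [List.eraseIdx_map, verts_erase_last]
          have e1 : ((verts v (a :: l)).map lam).eraseIdx 0 = (verts (v + stp a) l).map lam := by
            simp [verts]
          rw [e1] at h4
          exact h4.trans hpm.symm
        · rintro ⟨b, l', hl, hb⟩
          have hb2 : a = b := by
            have := List.append_inj_right' hl rfl
            simpa using this
          subst hb2
          rw [Pi.add_apply, stp_same] at hb
          rcases sg_cases a.2 with e | e <;> rw [e] at ha hb <;> omega
    · rintro ⟨⟨v, _ | ⟨a, l⟩⟩, j⟩ hz ⟨⟨v', _ | ⟨a', l'⟩⟩, j'⟩ hz' he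
      · simp [memOm] at hz
      · simp [memOm] at hz
      · simp [memOm] at hz'
      · simp only [Finset.mem_filter] at hz hz'
        simp only [Prod.mk.injEq] at he
        obtain ⟨⟨he1, he2⟩, _⟩ := he
        have e1 : l = l' := List.append_inj_left' he2 rfl
        have e2 : a = a' := by simpa using List.append_inj_right' he2 rfl
        subst e1; subst e2
        have e3 : v = v' := add_right_cancel he1
        rw [e3, hz.2.1, hz'.2.1]
    · rintro ⟨⟨w, l0⟩, j⟩ hz
      simp only [Finset.mem_filter, memOm, tl] at hz
      obtain ⟨⟨h1, h2, h3, h4⟩, rfl, h5⟩ := hz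
      obtain ⟨l, a, rfl⟩ : ∃ l a, l0 = l ++ [a] := by
        rcases List.eq_nil_or_concat l0 with h | ⟨l, a, h⟩
        · exact absurd h h2
        · exact ⟨l, a, by simpa using h⟩
      have h6 : w a.1 ≠ 0 := fun h => h5 ⟨a, l, rfl, h⟩
      have ha := h1.2.1 a (by simp)
      have hpm : (l ++ [a]).Perm (a :: l) := List.perm_append_singleton a l
      refine ⟨((w - stp a, a :: l), 0), ?_, ?_⟩
      · simp only [Finset.mem_filter, memOm, hd]
        refine ⟨⟨⟨(h1.perm hpm.symm).1, ?_, ?_⟩, by simp, by simp, ?_⟩, trivial, ?_⟩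
        · intro b hb
          by_cases hba : b.1 = a.1
          · have : b = a := List.inj_on_of_nodup_map h1.1 (hpm.mem_iff.2 hb) (by simp) hba
            rw [this, Pi.sub_apply, stp_same]
            rcases sg_cases a.2 with e | e <;> rw [e] at ha ⊢ <;> constructor <;> omega
          · rw [Pi.sub_apply, stp_other _ _ hba, sub_zero]
            exact h1.2.1 b (hpm.mem_iff.2 hb)
        · intro i hi
          have hia : i ≠ a.1 := fun h => hi a (by simp) h.symm
          rw [Pi.sub_apply, stp_other _ _ hia, sub_zero]
          exact h1.2.2 i fun b hb => hi b (hpm.mem_iff.1 hb)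
        · rw [List.length_append, List.length_singleton, List.eraseIdx_map,
            verts_erase_last] at h4
          have e1 : ((verts (w - stp a) (a :: l)).map lam).eraseIdx 0 = (verts w l).map lam := by
            simp [verts]
          rw [e1]
          exact h4.trans hpm
        · rintro ⟨b, l', hl, hb⟩
          have hb2 : a = b := (List.cons.inj hl).1
          subst hb2
          rw [Pi.sub_apply, stp_same] at hb
          rcases sg_cases a.2 with e | e <;> rw [e] at ha hb <;> omega
      · simp
  have hD : (V.filter Q).card
      = (Om.filter (fun z => z.2 = z.1.2.length ∧ tl z.1)).card := by
    have hQ : ∀ x ∈ V.filter Q, Q x := fun x hx => (Finset.mem_filter.1 hx).2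
    refine Finset.card_bij (fun x hx => ((x.1, x.2 ++ [(hQ x hx).choose]), x.2.length + 1))
      ?_ ?_ ?_
    · rintro ⟨v, l⟩ hx
      have h2 := (hQ _ hx).choose_spec
      set y := (hQ _ hx).choose
      have h1 := (memV _ _).1 (Finset.mem_filter.1 hx).1
      simp only at h2
      have hy : ∀ b ∈ l, b.1 ≠ y.1 := by
        intro b hb hby
        have hb' : b ∈ (verts v l).map lam := h2.2.mem_iff.2 (by simp [hb])
        have hy' : y ∈ (verts v l).map lam := h2.2.mem_iff.2 (by simp)
        obtain ⟨p, hp, hpb⟩ := List.mem_map.1 hb'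
        obtain ⟨q, hq, hqy⟩ := List.mem_map.1 hy'
        apply hcomp v l h1 p hp q hq
        rw [hpb, hqy]
        have hne : b ≠ y := fun h => h2.1 (h ▸ hb)
        refine Prod.ext hby.symm ?_
        have : b.2 ≠ y.2 := fun h => hne (Prod.ext hby h)
        simp only [nl]
        revert this
        cases b.2 <;> cases y.2 <;> simp
      obtain ⟨h3, h4⟩ := (valid_snoc hN hy).2 h1
      simp only [Finset.mem_filter, memOm, tl]
      refine ⟨⟨h3, by simp, by simp, ?_⟩, by simp, y, l, rfl, h4⟩
      rw [List.eraseIdx_map, verts_erase_last]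
      exact h2.2.trans (List.perm_append_singleton y l).symm
    · rintro ⟨v, l⟩ hx ⟨v', l'⟩ hx' he
      simp only [Prod.mk.injEq] at he ⊢
      exact ⟨he.1.1, List.append_inj_left' he.1.2 rfl⟩
    · rintro ⟨⟨v, l0⟩, j⟩ hz
      simp only [Finset.mem_filter, memOm, tl] at hz
      obtain ⟨⟨h1, h2, h3, h4⟩, rfl, a, l, rfl, h5⟩ := hz
      have hnd := h1.1
      rw [List.map_append, List.nodup_append] at hnd
      have ha : ∀ b ∈ l, b.1 ≠ a.1 := fun b hb =>
        hnd.2.2 b.1 (List.mem_map_of_mem hb) a.1 (by simp)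
      have h6 := (valid_snoc hN ha).1 ⟨h1, h5⟩
      rw [List.length_append, List.length_singleton, List.eraseIdx_map, verts_erase_last] at h4
      have hpm : (l ++ [a]).Perm (a :: l) := List.perm_append_singleton a l
      have hm : (v, l) ∈ V.filter Q := by
        refine Finset.mem_filter.2 ⟨(memV _ _).2 h6, a, fun h => ha a h rfl, h4.trans hpm⟩
      refine ⟨(v, l), hm, ?_⟩
      have h7 := (hQ _ hm).choose_spec
      have : (hQ _ hm).choose = a := by
        have h8 := h7.2.symm.trans (h4.trans hpm)
        by_contra hne
        have h9 : (hQ _ hm).choose ∈ a :: l := h8.mem_iff.1 (by simp)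
        rcases List.mem_cons.1 h9 with h | h
        · exact hne h
        · exact h7.1 h
      simp [this]
  have hsplit : Om.card = (Om.filter (fun z => 0 < z.2 ∧ z.2 < z.1.2.length)).card
      + ((Om.filter (fun z => z.2 = 0 ∧ hd z.1)).card
      + (Om.filter (fun z => z.2 = 0 ∧ ¬ hd z.1)).card)
      + ((Om.filter (fun z => z.2 = z.1.2.length ∧ tl z.1)).card
      + (Om.filter (fun z => z.2 = z.1.2.length ∧ ¬ tl z.1)).card) := by
    simp only [Finset.card_filter _ Om, ← Finset.sum_add_distrib]
    rw [Finset.card_eq_sum_ones]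
    apply Finset.sum_congr rfl
    rintro ⟨⟨v, l⟩, j⟩ hz
    obtain ⟨h1, h2, h3, h4⟩ := (memOm _ _ _).1 hz
    have hl : 0 < l.length := List.length_pos_iff.2 h2
    simp only
    by_cases c1 : hd (v, l) <;> by_cases c2 : tl (v, l) <;> simp only [c1, c2] <;>
    · rcases Nat.eq_zero_or_pos j with rfl | hj
      · simp [hl, hl.ne]
      · rcases h3.lt_or_eq with h | rfl
        · simp [hj, h, hj.ne', h.ne]
        · simp [hl, hl.ne']
  have hc := congrArg (Nat.cast : ℕ → ZMod 2) hsplit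
  rw [hZ, ← hD, hR0] at hc
  push_cast at hc
  rw [hR1, hmid, hbd] at hc
  have key : ∀ a b : ZMod 2, ¬ (a = 0 + (0 + b) + (a + 1 + b)) := by decide
  exact key _ _ hc

end CH

namespace CH

/-- Borsuk-Ulam, ball version. -/
theorem borsuk_ulam {n : ℕ} {R : ℝ} (hR : 0 < R) (f : (Fin n → ℝ) → (Fin n → ℝ))
    (hf : Continuous f) (hodd : ∀ x, ‖x‖ = R → f (-x) = - f x) : ∃ x, ‖x‖ ≤ R ∧ f x = 0 := by
  rcases Nat.eq_zero_or_pos n with rfl | hn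
  · exact ⟨0, by rw [norm_zero]; exact hR.le, Subsingleton.elim _ _⟩
  have : Nonempty (Fin n) := ⟨⟨0, hn⟩⟩
  by_contra hcon
  push Not at hcon
  have hK : IsCompact (Metric.closedBall (0 : Fin n → ℝ) R) := isCompact_closedBall _ _
  obtain ⟨x0, hx0, hmin⟩ := hK.exists_isMinOn ⟨0, by simp [hR.le]⟩ hf.norm.continuousOn
  set ε := ‖f x0‖ with hε
  have hεpos : 0 < ε := norm_pos_iff.2 (hcon x0 (by simpa using hx0))
  have hlow : ∀ x, ‖x‖ ≤ R → ε ≤ ‖f x‖ := fun x hx => hmin (by simpa using hx)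
  have huc := hK.uniformContinuousOn_of_continuous hf.continuousOn
  obtain ⟨δ, hδ, hclose⟩ := Metric.uniformContinuousOn_iff.1 huc ε hεpos
  obtain ⟨M, hM⟩ := exists_nat_gt (R / δ)
  have hMpos : (0 : ℝ) < M := lt_of_le_of_lt (by positivity) hM
  have hRM : R / M < δ := by
    rw [div_lt_iff₀ hδ] at hM
    rw [div_lt_iff₀ hMpos]; linarith
  let X : (Fin n → ℤ) → (Fin n → ℝ) := fun p i => R / M * p i
  have hRMpos : 0 < R / M := by positivity
  have hXneg : ∀ p, X (-p) = - X p := by intro p; ext i; simp [X]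
  have hXabs : ∀ p i, |X p i| = R / M * (|p i| : ℤ) := by
    intro p i
    simp only [X, abs_mul, abs_of_pos hRMpos, Int.cast_abs]
  have hXle : ∀ p, (∀ i, |p i| ≤ (M : ℤ)) → ‖X p‖ ≤ R := by
    intro p hp
    rw [pi_norm_le_iff_of_nonneg hR.le]
    intro i
    rw [Real.norm_eq_abs, hXabs]
    have : ((|p i| : ℤ) : ℝ) ≤ M := by exact_mod_cast hp i
    calc R / M * (|p i| : ℤ) ≤ R / M * M := by gcongr
      _ = R := by field_simp
  let I : (Fin n → ℝ) → Fin n := fun x => Classical.epsilon (fun i => ε ≤ |f x i|)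
  have hI : ∀ x, ‖x‖ ≤ R → ε ≤ |f x (I x)| := by
    intro x hx
    apply Classical.epsilon_spec (p := fun i => ε ≤ |f x i|)
    by_contra hno
    push Not at hno
    have : ‖f x‖ < ε := (pi_norm_lt_iff hεpos).2 fun i => by
      rw [Real.norm_eq_abs]; exact hno i
    exact absurd (hlow x hx) (not_le.2 this)
  let lam : (Fin n → ℤ) → Lab n := fun p => (I (X p), decide (0 < f (X p) (I (X p))))
  obtain ⟨p, q, hp, hq, hpq, hl⟩ := tucker (N := M) (by exact_mod_cast hMpos) lam (by
    intro p hp ⟨i, hi⟩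
    have hn : ‖X p‖ = R := by
      apply le_antisymm (hXle p hp)
      have := norm_le_pi_norm (X p) i
      rw [Real.norm_eq_abs, hXabs, hi] at this
      have h2 : R / M * ((M : ℤ) : ℝ) = R := by push_cast; field_simp
      linarith
    have ho := hodd _ hn
    have hII : I (X (-p)) = I (X p) := by
      simp only [I, hXneg, ho, Pi.neg_apply, abs_neg]
    refine Prod.ext hII ?_
    simp only [lam, nl]
    rw [hII, hXneg, ho, Pi.neg_apply]
    have h3 := hI (X p) hn.le
    have hne : f (X p) (I (X p)) ≠ 0 := by
      intro h; rw [h, abs_zero] at h3; linarith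
    rcases lt_or_gt_of_ne hne with h | h
    · simp [h, not_lt.2 h.le]
    · simp [h, h.le])
  have hd : dist (X p) (X q) < δ := by
    refine lt_of_le_of_lt ?_ hRM
    rw [dist_pi_le_iff hRMpos.le]
    intro i
    rw [Real.dist_eq]
    have e : X p i - X q i = R / M * ((p i - q i : ℤ) : ℝ) := by simp only [X]; push_cast; ring
    rw [e, abs_mul, abs_of_pos hRMpos]
    have : |((p i - q i : ℤ) : ℝ)| ≤ 1 := by exact_mod_cast hpq i
    nlinarith
  have hd2 := hclose (X p) (by simpa using hXle p hp) (X q) (by simpa using hXle q hq) hd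
  have e1 : I (X q) = I (X p) := congrArg Prod.fst hl
  have e2 : decide (0 < f (X q) (I (X q))) = !decide (0 < f (X p) (I (X p))) :=
    congrArg Prod.snd hl
  have h1 := hI _ (hXle p hp)
  have h2 := hI _ (hXle q hq)
  rw [e1] at e2 h2
  have h3 := (dist_le_pi_dist (f (X p)) (f (X q)) (I (X p))).trans_lt hd2
  rw [Real.dist_eq] at h3
  set a := f (X p) (I (X p))
  set b := f (X q) (I (X p))
  rw [abs_lt] at h3
  by_cases ha : 0 < a
  · have hb : ¬ 0 < b := by simpa [ha] using e2
    rw [abs_of_pos ha] at h1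
    rw [abs_of_nonpos (not_lt.1 hb)] at h2
    linarith
  · have hb : 0 < b := by simpa [ha] using e2
    rw [abs_of_nonpos (not_lt.1 ha)] at h1
    rw [abs_of_pos hb] at h2
    linarith

end CH

namespace CH

/-- a 1-periodic even gauge vanishing exactly on the integers -/
noncomputable def gd (x : ℝ) : ℝ := Real.sin (Real.pi * x) ^ 2

lemma gd_nonneg (x : ℝ) : 0 ≤ gd x := sq_nonneg _

lemma gd_neg (x : ℝ) : gd (-x) = gd x := by simp [gd]

lemma gd_cont : Continuous gd := by unfold gd; fun_prop

lemma gd_int (z : ℤ) : gd z = 0 := by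
  have : Real.sin (Real.pi * z) = 0 := by rw [mul_comm]; exact Real.sin_int_mul_pi z
  simp [gd, this]

lemma gd_half (z : ℤ) : gd (z - 1 / 2) = 1 := by
  have : Real.pi * ((z : ℝ) - 1 / 2) = z * Real.pi - Real.pi / 2 := by ring
  have h := Real.sin_sq_add_cos_sq (z * Real.pi)
  rw [Real.sin_int_mul_pi] at h
  rw [gd, this, Real.sin_sub_pi_div_two]
  linarith [h]

lemma floor_neg_of (x : ℝ) (h : ∀ z : ℤ, x ≠ z) : ⌊-x⌋ = -⌊x⌋ - 1 := by
  rw [Int.floor_eq_iff]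
  have h1 := Int.floor_le x
  have h2 := Int.lt_floor_add_one x
  have h3 : (⌊x⌋ : ℝ) < x := lt_of_le_of_ne h1 (h _).symm
  push_cast
  constructor <;> linarith

lemma floor_loc (x : ℝ) (h : ∀ z : ℤ, x ≠ z) : ∀ᶠ y in nhds x, ⌊y⌋ = ⌊x⌋ := by
  have h1 := Int.floor_le x
  have h2 := Int.lt_floor_add_one x
  have h3 : (⌊x⌋ : ℝ) < x := lt_of_le_of_ne h1 (h _).symm
  filter_upwards [Ioo_mem_nhds h3 h2] with y hy
  exact Int.floor_eq_iff.2 ⟨hy.1.le, hy.2⟩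

open Classical in
noncomputable def uF {n : ℕ} (F : Finset (Fin n)) (x : Fin n → ℝ) : ℝ :=
  (∏ i ∈ F, max 0 (1 - gd (x i))) * (∏ l ∈ Fᶜ, gd (x l)) *
    ∏ i ∈ F, ∏ l ∈ Fᶜ, max 0 (gd (x l) - gd (x i))

open Classical in
noncomputable def qF {n : ℕ} (F : Finset (Fin n)) (x : Fin n → ℝ) : Fin n → ℝ := fun i =>
  if i ∈ F then (⌊x i + 1 / 2⌋ : ℝ) else ⌊x i⌋ + 1 / 2

section
variable {n : ℕ} (F : Finset (Fin n)) (x : Fin n → ℝ)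

lemma uF_nonneg : 0 ≤ uF F x := by
  unfold uF
  refine mul_nonneg (mul_nonneg ?_ ?_) ?_
  · exact Finset.prod_nonneg fun i _ => le_max_left _ _
  · exact Finset.prod_nonneg fun i _ => gd_nonneg _
  · exact Finset.prod_nonneg fun i _ => Finset.prod_nonneg fun l _ => le_max_left _ _

lemma uF_cont : Continuous (uF F) := by
  have := gd_cont
  unfold uF
  fun_prop

lemma uF_neg : uF F (-x) = uF F x := by simp [uF, gd_neg]

lemma uF_spec (h : uF F x ≠ 0) : (∀ i ∈ F, gd (x i) < 1) ∧ (∀ l ∉ F, 0 < gd (x l)) ∧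
    ∀ i ∈ F, ∀ l ∉ F, gd (x i) < gd (x l) := by
  unfold uF at h
  obtain ⟨h12, h3⟩ := mul_ne_zero_iff.1 h
  obtain ⟨h1, h2⟩ := mul_ne_zero_iff.1 h12
  rw [Finset.prod_ne_zero_iff] at h1 h2 h3
  refine ⟨fun i hi => ?_, fun l hl => ?_, fun i hi l hl => ?_⟩
  · by_contra hc
    exact h1 i hi (max_eq_left (by linarith))
  · exact lt_of_le_of_ne (gd_nonneg _) (h2 l (by simpa using hl)).symm
  · have h4 := Finset.prod_ne_zero_iff.1 (h3 i hi) l (by simpa using hl)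
    by_contra hc
    exact h4 (max_eq_left (by linarith))

lemma exists_uF : ∃ F, 0 < uF F x := by
  classical
  refine ⟨Finset.univ.filter (fun i => gd (x i) = 0), ?_⟩
  have hF : ∀ i, i ∈ (Finset.univ.filter (fun i => gd (x i) = 0)) ↔ gd (x i) = 0 := by simp
  have hpos : ∀ l, gd (x l) ≠ 0 → 0 < gd (x l) := fun l hl => lt_of_le_of_ne (gd_nonneg _) hl.symm
  unfold uF
  refine mul_pos (mul_pos ?_ ?_) ?_
  · refine Finset.prod_pos fun i hi => ?_
    rw [(hF i).1 hi]; norm_num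
  · refine Finset.prod_pos fun l hl => ?_
    rw [Finset.mem_compl, hF] at hl
    exact hpos l hl
  · refine Finset.prod_pos fun i hi => Finset.prod_pos fun l hl => ?_
    rw [Finset.mem_compl, hF] at hl
    rw [(hF i).1 hi, sub_zero]
    exact lt_max_of_lt_right (hpos l hl)

lemma uF_unique {F G : Finset (Fin n)} (hc : (Fᶜ).card = (Gᶜ).card)
    (hF : uF F x ≠ 0) (hG : uF G x ≠ 0) : F = G := by
  classical
  have hc' : F.card = G.card := by
    rw [Finset.card_compl, Finset.card_compl] at hc
    have h1 := Finset.card_le_univ F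
    have h2 := Finset.card_le_univ G
    omega
  by_contra hne
  have h1 : ¬ F ⊆ G := fun h => hne (Finset.eq_of_subset_of_card_le h hc'.ge)
  have h2 : ¬ G ⊆ F := fun h => hne (Finset.eq_of_subset_of_card_le h hc'.le).symm
  obtain ⟨i, hi, hi'⟩ := Finset.not_subset.1 h1
  obtain ⟨l, hl, hl'⟩ := Finset.not_subset.1 h2
  have a := (uF_spec F x hF).2.2 i hi l hl'
  have b := (uF_spec G x hG).2.2 l hl i hi'
  linarith

lemma ne_int_of_pos {y : ℝ} (h : 0 < gd y) (z : ℤ) : y ≠ z := by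
  rintro rfl; rw [gd_int] at h; exact lt_irrefl _ h

lemma ne_half_of_lt {y : ℝ} (h : gd y < 1) (z : ℤ) : y + 1 / 2 ≠ z := by
  intro e
  have : y = z - 1 / 2 := by linarith
  rw [this, gd_half] at h; exact lt_irrefl _ h

lemma qF_neg (h : uF F x ≠ 0) : qF F (-x) = - qF F x := by
  obtain ⟨h1, h2, -⟩ := uF_spec F x h
  ext i
  by_cases hi : i ∈ F
  · simp only [qF, hi, if_true, Pi.neg_apply]
    have := floor_neg_of _ (ne_half_of_lt (h1 i hi))
    have e : -x i + 1 / 2 = -(x i + 1 / 2) + 1 := by ring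
    rw [e, Int.floor_add_one, this]
    push_cast; ring
  · simp only [qF, hi, if_false, Pi.neg_apply]
    rw [floor_neg_of _ (ne_int_of_pos (h2 i hi))]
    push_cast; ring

lemma qF_loc (h : uF F x ≠ 0) : ∀ᶠ y in nhds x, qF F y = qF F x := by
  obtain ⟨h1, h2, -⟩ := uF_spec F x h
  have : ∀ᶠ y in nhds x, ∀ i, qF F y i = qF F x i := by
    rw [Filter.eventually_all]
    intro i
    have hc : Filter.Tendsto (fun y : Fin n → ℝ => y i) (nhds x) (nhds (x i)) :=
      (continuous_apply i).continuousAt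
    by_cases hi : i ∈ F
    · have hc2 : Filter.Tendsto (fun y : Fin n → ℝ => y i + 1 / 2) (nhds x) (nhds (x i + 1 / 2)) :=
        hc.add_const _
      filter_upwards [hc2.eventually (floor_loc _ (ne_half_of_lt (h1 i hi)))] with y hy
      simp only [qF, hi, if_true, hy]
    · filter_upwards [hc.eventually (floor_loc _ (ne_int_of_pos (h2 i hi)))] with y hy
      simp only [qF, hi, if_false, hy]
  filter_upwards [this] with y hy
  exact funext hy

lemma qF_dist : dist (qF F x) x ≤ 1 / 2 := by
  rw [dist_pi_le_iff (by norm_num)]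
  intro i
  rw [Real.dist_eq, abs_le]
  by_cases hi : i ∈ F
  · simp only [qF, hi, if_true]
    have h1 := Int.floor_le (x i + 1 / 2)
    have h2 := Int.lt_floor_add_one (x i + 1 / 2)
    constructor <;> linarith
  · simp only [qF, hi, if_false]
    have h1 := Int.floor_le (x i)
    have h2 := Int.lt_floor_add_one (x i)
    constructor <;> linarith

end

lemma cont_piece {n : ℕ} (F : Finset (Fin n)) (g : (Fin n → ℝ) → (Fin n → ℝ)) (C : ℝ)
    (hC : ∀ p, ‖g p‖ ≤ C) : Continuous (fun x => uF F x • g (qF F x)) := by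
  rw [continuous_iff_continuousAt]
  intro x
  by_cases h : uF F x = 0
  · have h0 : uF F x • g (qF F x) = 0 := by simp [h]
    rw [ContinuousAt, h0]
    have hu : Filter.Tendsto (uF F) (nhds x) (nhds 0) := by
      rw [← h]; exact (uF_cont F).continuousAt
    refine squeeze_zero_norm (a := fun y => uF F y * C) (fun y => ?_) ?_
    · rw [norm_smul, Real.norm_of_nonneg (uF_nonneg F y)]
      exact mul_le_mul_of_nonneg_left (hC _) (uF_nonneg F y)
    · simpa using hu.mul_const C
  · have h1 : ContinuousAt (fun y => uF F y • g (qF F x)) x :=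
      ((uF_cont F).smul continuous_const).continuousAt
    refine h1.congr ?_
    filter_upwards [qF_loc F x h] with y hy
    rw [hy]

open Classical in
theorem colored_zero {n : ℕ} {N : ℕ} (hN : 0 < N)
    (g : Fin (n + 1) → (Fin n → ℝ) → (Fin n → ℝ)) (C : ℝ) (hC : ∀ m p, ‖g m p‖ ≤ C)
    (hodd : ∀ m p, 1 ≤ ‖p‖ → g m (-p) = - g m p) :
    ∃ (x : Fin n → ℝ) (p : Fin (n + 1) → (Fin n → ℝ)) (w : Fin (n + 1) → ℝ), ‖x‖ ≤ 1 ∧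
      (∀ m, dist (p m) x ≤ 1 / N) ∧ (∀ m, 0 ≤ w m) ∧ 0 < ∑ m, w m ∧
      ∑ m, w m • g m (p m) = 0 := by
  have hN' : (0 : ℝ) < N := by exact_mod_cast hN
  let col : Finset (Fin n) → Fin (n + 1) := fun F =>
    ⟨(Fᶜ).card, Nat.lt_succ_of_le (by simpa using Finset.card_le_univ (Fᶜ))⟩
  let sc : (Fin n → ℝ) → (Fin n → ℝ) := fun x => (N : ℝ)⁻¹ • x
  let H : (Fin n → ℝ) → (Fin n → ℝ) := fun x =>
    ∑ F : Finset (Fin n), uF F x • g (col F) (sc (qF F x))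
  have hH : Continuous H := continuous_finsetSum _ fun F _ =>
    cont_piece F (fun p => g (col F) (sc p)) C fun p => hC _ _
  obtain ⟨x, hx, hx0⟩ := borsuk_ulam hN' H hH (by
    intro x hx
    simp only [H, ← Finset.sum_neg_distrib]
    refine Finset.sum_congr rfl fun F _ => ?_
    rw [uF_neg]
    by_cases h : uF F x = 0
    · simp [h]
    · have hs : sc (qF F (-x)) = - sc (qF F x) := by rw [qF_neg F x h]; simp [sc]
      rw [hs, hodd, smul_neg]
      obtain ⟨i, hi⟩ : ∃ i, |x i| = N := by
        by_contra hno
        push Not at hno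
        have : ‖x‖ < N := (pi_norm_lt_iff hN').2 fun i => by
          refine lt_of_le_of_ne ?_ (by simpa using hno i)
          rw [← hx]; exact norm_le_pi_norm x i
        linarith
      obtain ⟨z, hz, hzN⟩ : ∃ z : ℤ, x i = z ∧ |(z : ℝ)| = N := by
        rcases abs_eq hN'.le |>.1 hi with h | h
        · exact ⟨N, by simp [h], by simp⟩
        · exact ⟨-N, by simp [h], by simp⟩
      have hiF : i ∈ F := by
        by_contra hiF
        have := (uF_spec F x h).2.1 i hiF
        rw [hz, gd_int] at this
        exact lt_irrefl _ this
      have hq : qF F x i = z := by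
        simp only [qF, hiF, if_true, hz]
        rw [Int.floor_intCast_add]
        norm_num
      have := norm_le_pi_norm (sc (qF F x)) i
      simp only [sc, Pi.smul_apply, smul_eq_mul, hq, Real.norm_eq_abs, abs_mul, hzN] at this
      rw [abs_of_pos (inv_pos.2 hN'), inv_mul_cancel₀ hN'.ne'] at this
      exact this)
  -- the colour representatives
  let rep : Fin (n + 1) → Finset (Fin n) := fun m =>
    if h : ∃ F, uF F x ≠ 0 ∧ col F = m then h.choose else ∅
  have hrep : ∀ F, uF F x ≠ 0 → rep (col F) = F := by
    intro F hF
    have h : ∃ G, uF G x ≠ 0 ∧ col G = col F := ⟨F, hF, rfl⟩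
    simp only [rep, dif_pos h]
    exact uF_unique x (by simpa [col] using h.choose_spec.2) h.choose_spec.1 hF
  have hscd : ∀ y z : Fin n → ℝ, dist (sc y) (sc z) = (N : ℝ)⁻¹ * dist y z := by
    intro y z
    simp only [sc]
    rw [dist_smul₀, Real.norm_of_nonneg (inv_pos.2 hN').le]
  refine ⟨sc x, fun m => sc (qF (rep m) x),
    fun m => ∑ F ∈ Finset.univ.filter (fun F => col F = m), uF F x, ?_, ?_, ?_, ?_, ?_⟩
  · simp only [sc]
    rw [norm_smul, Real.norm_of_nonneg (inv_pos.2 hN').le, inv_mul_le_iff₀ hN']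
    simpa using hx
  · intro m
    rw [hscd, one_div]
    have := qF_dist (rep m) x
    have h2 : (0 : ℝ) < (N : ℝ)⁻¹ := inv_pos.2 hN'
    nlinarith
  · intro m
    exact Finset.sum_nonneg fun F _ => uF_nonneg F x
  · rw [Finset.sum_fiberwise]
    obtain ⟨F, hF⟩ := exists_uF x
    exact Finset.sum_pos' (fun F _ => uF_nonneg F x) ⟨F, Finset.mem_univ _, hF⟩
  · rw [← hx0]
    simp only [H]
    rw [← Finset.sum_fiberwise Finset.univ col]
    refine Finset.sum_congr rfl fun m _ => ?_
    rw [Finset.sum_smul]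
    refine Finset.sum_congr rfl fun F hF => ?_
    have hFm : col F = m := (Finset.mem_filter.1 hF).2
    by_cases h : uF F x = 0
    · simp [h]
    · rw [← hFm, hrep F h]

end CH

namespace CH

lemma finite_reduction {E ι κ : Type*} [AddCommGroup E] [Module ℝ E] [Finite ι] [Fintype κ]
    [DecidableEq κ] (A : ι → Set E) (hne : ∀ i, (A i).Nonempty) :
    ∃ P : ι → Set E, (∀ i, (P i).Finite) ∧ (∀ i, (P i).Nonempty) ∧ (∀ i, P i ⊆ A i) ∧
      ∀ (t : κ → ι) (S : Finset κ),
        convexHull ℝ (⋃ j ∈ S, P (t j)) ∩ convexHull ℝ (⋃ j ∈ Sᶜ, P (t j)) = ∅ →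
        convexHull ℝ (⋃ j ∈ S, A (t j)) ∩ convexHull ℝ (⋃ j ∈ Sᶜ, A (t j)) = ∅ := by
  have h : ∀ x : (κ → ι) × Finset κ, ∃ Z Z' : Finset E,
      (convexHull ℝ (⋃ j ∈ x.2, A (x.1 j)) ∩ convexHull ℝ (⋃ j ∈ x.2ᶜ, A (x.1 j))).Nonempty →
      (Z : Set E) ⊆ (⋃ j ∈ x.2, A (x.1 j)) ∧ (Z' : Set E) ⊆ (⋃ j ∈ x.2ᶜ, A (x.1 j)) ∧
      (convexHull ℝ (Z : Set E) ∩ convexHull ℝ (Z' : Set E)).Nonempty := by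
    intro x
    by_cases hx : (convexHull ℝ (⋃ j ∈ x.2, A (x.1 j)) ∩
        convexHull ℝ (⋃ j ∈ x.2ᶜ, A (x.1 j))).Nonempty
    · obtain ⟨z, h1, h2⟩ := hx
      rw [convexHull_eq_union_convexHull_finite_subsets] at h1 h2
      simp only [Set.mem_iUnion] at h1 h2
      obtain ⟨Z, hZ, hz⟩ := h1
      obtain ⟨Z', hZ', hz'⟩ := h2
      exact ⟨Z, Z', fun _ => ⟨hZ, hZ', z, hz, hz'⟩⟩
    · exact ⟨∅, ∅, fun h => absurd h hx⟩
  choose Z Z' hZ using h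
  choose b hb using hne
  refine ⟨fun i => A i ∩ ({b i} ∪ ⋃ x, ((Z x : Set E) ∪ Z' x)), fun i => ?_, fun i => ?_,
    fun i => Set.inter_subset_left, ?_⟩
  · refine Set.Finite.inter_of_right ?_ _
    refine (Set.finite_singleton _).union (Set.finite_iUnion fun x => ?_)
    exact (Z x).finite_toSet.union (Z' x).finite_toSet
  · exact ⟨b i, hb i, by simp⟩
  · intro t S hP
    by_contra hA
    obtain ⟨h1, h2, z, hz, hz'⟩ := hZ (t, S) (Set.nonempty_iff_ne_empty.2 hA)
    have : z ∈ (∅ : Set E) := by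
      rw [← hP]
      refine ⟨convexHull_mono ?_ hz, convexHull_mono ?_ hz'⟩
      · intro y hy
        have := h1 hy
        simp only [Set.mem_iUnion] at this ⊢
        obtain ⟨j, hj, hyj⟩ := this
        exact ⟨j, hj, hyj, Or.inr (Set.mem_iUnion.2 ⟨(t, S), Or.inl hy⟩)⟩
      · intro y hy
        have := h2 hy
        simp only [Set.mem_iUnion] at this ⊢
        obtain ⟨j, hj, hyj⟩ := this
        exact ⟨j, hj, hyj, Or.inr (Set.mem_iUnion.2 ⟨(t, S), Or.inr hy⟩)⟩
    exact this

noncomputable def sr (b : Bool) : ℝ := if b then 1 else -1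

lemma sr_not (b : Bool) : sr (!b) = - sr b := by cases b <;> simp [sr]

/-- hemisphere parametrization -/
noncomputable def hm {n : ℕ} (y : Fin n → ℝ) : (Fin n → ℝ) × ℝ := (y, max 0 (1 - ‖y‖))

lemma hm_cont {n : ℕ} : Continuous (hm (n := n)) := by unfold hm; fun_prop

lemma hm_ne {n : ℕ} (y : Fin n → ℝ) : hm y ≠ 0 := by
  intro h
  have h1 : y = 0 := congrArg Prod.fst h
  have h2 : max 0 (1 - ‖y‖) = 0 := congrArg Prod.snd h
  rw [h1] at h2
  norm_num at h2

lemma hm_neg {n : ℕ} (y : Fin n → ℝ) (h : 1 ≤ ‖y‖) : hm (-y) = - hm y := by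
  have : max 0 (1 - ‖y‖) = 0 := max_eq_left (by linarith)
  simp [hm, this]

lemma hm_dist {n : ℕ} (x y : Fin n → ℝ) : dist (hm x) (hm y) ≤ dist x y := by
  rw [Prod.dist_eq]
  refine max_le le_rfl ?_
  simp only [hm]
  rw [Real.dist_eq]
  have h1 : |max 0 (1 - ‖x‖) - max 0 (1 - ‖y‖)| ≤ |(1 - ‖x‖) - (1 - ‖y‖)| := by
    have := abs_max_sub_max_le_max 0 (1 - ‖x‖) 0 (1 - ‖y‖)
    simpa using this
  refine h1.trans ?_
  have h2 : (1 - ‖x‖) - (1 - ‖y‖) = ‖y‖ - ‖x‖ := by ring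
  rw [h2, dist_comm, dist_eq_norm]
  exact abs_norm_sub_norm_le y x

open RealInnerProductSpace

/-- Abstract selection of odd labels along the hemisphere. -/
lemma exists_labels {E ι : Type*} [NormedAddCommGroup E] [InnerProductSpace ℝ E] [Finite ι]
    {n q : ℕ} (emb : (Fin n → ℝ) →ₗ[ℝ] E) (P : ι → Set E) (hfin : ∀ i, (P i).Finite)
    (c : ι → Fin q)
    (hsep : ∀ z : (Fin n → ℝ) × ℝ, z ≠ 0 → ∀ j, ∃ i b, c i = j ∧
      ∀ x ∈ P i, 0 < sr b * (⟪x, emb z.1⟫ - z.2)) :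
    ∃ (δ : ℝ) (L : Fin q → (Fin n → ℝ) → ι × Bool), 0 < δ ∧
      (∀ m p, 1 ≤ ‖p‖ → L m (-p) = ((L m p).1, !(L m p).2)) ∧
      (∀ m p y, ‖p‖ ≤ 2 → dist y p < δ → c (L m p).1 = m ∧
        ∀ x ∈ P (L m p).1, 0 < sr (L m p).2 * (⟪x, emb (hm y).1⟫ - (hm y).2)) := by
  classical
  have hembc : Continuous emb := emb.continuous_of_finiteDimensional
  let U : (Fin q → ι × Bool) → Set ((Fin n → ℝ) × ℝ) := fun L =>
    {z | ∀ j, c (L j).1 = j ∧ ∀ x ∈ P (L j).1, 0 < sr (L j).2 * (⟪x, emb z.1⟫ - z.2)}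
  have hU : ∀ L, IsOpen (U L) := by
    intro L
    have : U L = ⋂ j, ({z | c (L j).1 = j} ∩
        ⋂ x ∈ P (L j).1, {z | 0 < sr (L j).2 * (⟪x, emb z.1⟫ - z.2)}) := by
      ext z; simp [U]
    rw [this]
    refine isOpen_iInter_of_finite fun j => isOpen_const.inter ?_
    refine (hfin _).isOpen_biInter fun x _ => ?_
    refine isOpen_lt continuous_const ?_
    have h1 : Continuous fun z : (Fin n → ℝ) × ℝ => emb z.1 := hembc.comp continuous_fst
    fun_prop
  have hUneg : ∀ L z, z ∈ U L → -z ∈ U (fun j => ((L j).1, !(L j).2)) := by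
    intro L z hz j
    refine ⟨(hz j).1, fun x hx => ?_⟩
    have := (hz j).2 x hx
    simp only [sr_not, Prod.fst_neg, Prod.snd_neg, map_neg, inner_neg_right]
    linarith
  have hK : IsCompact (hm '' Metric.closedBall (0 : Fin n → ℝ) 2) :=
    (isCompact_closedBall _ _).image hm_cont
  obtain ⟨δ, hδ, hleb⟩ := lebesgue_number_lemma_of_metric hK hU (by
    rintro z ⟨y, -, rfl⟩
    choose i b h1 h2 using hsep (hm y) (hm_ne y)
    exact Set.mem_iUnion.2 ⟨fun j => (i j, b j), fun j => ⟨h1 j, h2 j⟩⟩)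
  have hne : Nonempty (Fin q → ι × Bool) := by
    obtain ⟨L, -⟩ := hleb (hm 0) ⟨0, by simp, rfl⟩
    exact ⟨L⟩
  have hL0 : ∀ p : Fin n → ℝ, ∃ L, ‖p‖ ≤ 2 → Metric.ball (hm p) δ ⊆ U L := by
    intro p
    by_cases hp : ‖p‖ ≤ 2
    · obtain ⟨L, hL⟩ := hleb (hm p) ⟨p, by simpa using hp, rfl⟩
      exact ⟨L, fun _ => hL⟩
    · exact ⟨hne.some, fun h => absurd h hp⟩
  choose L0 hL0 using hL0
  let Pos : (Fin n → ℝ) → Prop := fun p => ∃ i, 0 < p i ∧ ∀ j < i, p j = 0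
  have hPos : ∀ p, p ≠ 0 → (Pos (-p) ↔ ¬ Pos p) := by
    intro p hp
    have hex : (Finset.univ.filter fun i => p i ≠ 0).Nonempty := by
      by_contra h
      rw [Finset.not_nonempty_iff_eq_empty, Finset.filter_eq_empty_iff] at h
      exact hp (funext fun i => by simpa using h (Finset.mem_univ i))
    obtain ⟨i, hi, hmin⟩ := Finset.exists_min_image _ id hex
    have hi0 : p i ≠ 0 := by simpa using hi
    have hlow : ∀ j < i, p j = 0 := by
      intro j hj
      by_contra h
      have := hmin j (by simpa using h)
      exact absurd hj (not_lt.2 this)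
    constructor
    · rintro ⟨a, ha, ha'⟩ ⟨b, hb, hb'⟩
      simp only [Pi.neg_apply, neg_eq_zero] at ha ha'
      rcases lt_trichotomy a b with h | h | h
      · have := hb' a h; linarith
      · subst h; linarith
      · have := ha' b h; linarith
    · intro h
      refine ⟨i, ?_, fun j hj => by simp [hlow j hj]⟩
      rcases lt_or_gt_of_ne hi0 with h' | h'
      · simpa using h'
      · exact absurd ⟨i, h', hlow⟩ h
  let L : (Fin n → ℝ) → Fin q → ι × Bool := fun p =>
    if 1 ≤ ‖p‖ ∧ ¬ Pos p then fun j => ((L0 (-p) j).1, !(L0 (-p) j).2) else L0 p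
  refine ⟨δ, fun m p => L p m, hδ, ?_, ?_⟩
  · intro m p hp
    have hp0 : p ≠ 0 := by rintro rfl; norm_num at hp
    by_cases h : Pos p
    · have h' : ¬ Pos (-p) := by rw [hPos p hp0]; simpa using h
      simp [L, h, h', hp]
    · have h' : Pos (-p) := (hPos p hp0).2 h
      simp [L, h, h', hp]
  · intro m p y hp hy
    have hball : Metric.ball (hm p) δ ⊆ U (L p) := by
      by_cases h : 1 ≤ ‖p‖ ∧ ¬ Pos p
      · have e : L p = fun j => ((L0 (-p) j).1, !(L0 (-p) j).2) := by simp only [L]; rw [if_pos h]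
        rw [e]
        intro z hz
        have := hL0 (-p) (by simpa using hp) (a := -z) (by
          rw [hm_neg p h.1, Metric.mem_ball, dist_neg_neg]; exact hz)
        have := hUneg _ _ this
        rwa [neg_neg] at this
      · have e : L p = L0 p := by simp only [L]; rw [if_neg h]
        rw [e]
        exact hL0 p hp
    exact hball (Metric.mem_ball.2 ((hm_dist y p).trans_lt hy)) m

end CH

namespace CH

lemma one_side {E : Type*} [NormedAddCommGroup E] [InnerProductSpace ℝ E] (A : Set E)
    (hA : Convex ℝ A) (w : E) (a : ℝ) (h : ¬ (A ∩ {x | ⟪x, w⟫ = a}).Nonempty) :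
    ∃ b, ∀ x ∈ A, 0 < sr b * (⟪x, w⟫ - a) := by
  by_cases h1 : ∀ x ∈ A, a < ⟪x, w⟫
  · exact ⟨true, fun x hx => by have := h1 x hx; simp [sr]; linarith⟩
  by_cases h2 : ∀ x ∈ A, ⟪x, w⟫ < a
  · exact ⟨false, fun x hx => by have := h2 x hx; simp [sr]; linarith⟩
  exfalso
  push Not at h1 h2
  obtain ⟨x, hx, hxa⟩ := h1
  obtain ⟨y, hy, hya⟩ := h2
  have hc := hA.isPreconnected.intermediate_value hx hy
    (f := fun z => (⟪z, w⟫ : ℝ)) (by fun_prop) ⟨hxa, hya⟩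
  obtain ⟨z, hz, hza⟩ := hc
  exact h ⟨z, hz, hza⟩

lemma hulls_disj {E : Type*} [NormedAddCommGroup E] [InnerProductSpace ℝ E] (X Y : Set E)
    (w : E) (a : ℝ) (hX : ∀ x ∈ X, a < ⟪x, w⟫) (hY : ∀ x ∈ Y, ⟪x, w⟫ < a) :
    convexHull ℝ X ∩ convexHull ℝ Y = ∅ := by
  have hl : IsLinearMap ℝ (fun x : E => (⟪x, w⟫ : ℝ)) :=
    ⟨fun x y => inner_add_left _ _ _, fun r x => by simp [inner_smul_left]⟩
  have h1 := convexHull_min (t := {x : E | a < ⟪x, w⟫}) hX (convex_halfSpace_gt hl a)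
  have h2 := convexHull_min (t := {x : E | (⟪x, w⟫ : ℝ) < a}) hY (convex_halfSpace_lt hl a)
  rw [Set.eq_empty_iff_forall_notMem]
  rintro x ⟨hx, hy⟩
  have h3 : a < ⟪x, w⟫ := h1 hx
  have h4 : ⟪x, w⟫ < a := h2 hy
  exact lt_asymm h3 h4

noncomputable def emb (n d : ℕ) (h : n ≤ d) : (Fin n → ℝ) →ₗ[ℝ] EuclideanSpace ℝ (Fin d) where
  toFun w := ∑ i, w i • EuclideanSpace.single (Fin.castLE h i) (1 : ℝ)
  map_add' x y := by simp [add_smul, Finset.sum_add_distrib]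
  map_smul' r x := by simp [mul_smul, Finset.smul_sum]

lemma emb_apply (n d : ℕ) (h : n ≤ d) (w : Fin n → ℝ) (i : Fin n) :
    emb n d h w (Fin.castLE h i) = w i := by
  simp [emb, Pi.single_apply]

/-- A signed vanishing combination of the lifted points gives a Radon intersection. -/
lemma radon_point {k : ℕ} {M : Type*} [Fintype M] [DecidableEq M]
    (f : M → EuclideanSpace ℝ (Fin k))
    (b : M → Bool) (w : M → ℝ) (hw : ∀ m, 0 ≤ w m) (hs : 0 < ∑ m, w m)
    (h : ∑ m, w m • (sr (b m) • (Fin.cons 1 (fun i => f m i) : Fin (k+1) → ℝ)) = 0)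
    (S : Finset M) (hS : ∀ m, m ∈ S ↔ b m = true) :
    (convexHull ℝ (f '' (S : Set M)) ∩
      convexHull ℝ (f '' ((Sᶜ : Finset M) : Set M))).Nonempty := by
  have key : ∀ u : M → ℝ, ∑ m, w m * (sr (b m) * u m) =
      ∑ m ∈ S, w m * u m - ∑ m ∈ Sᶜ, w m * u m := by
    intro u
    rw [← Finset.sum_add_sum_compl S, sub_eq_add_neg, ← Finset.sum_neg_distrib]
    congr 1
    · refine Finset.sum_congr rfl fun m hm => ?_
      have := (hS m).1 hm
      simp [this, sr]
    · refine Finset.sum_congr rfl fun m hm => ?_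
      have : b m ≠ true := fun e => (Finset.mem_compl.1 hm) ((hS m).2 e)
      simp [this, sr]
  have h0 : ∑ m ∈ S, w m = ∑ m ∈ Sᶜ, w m := by
    have e := congrFun h 0
    simp only [Finset.sum_apply, Pi.smul_apply, smul_eq_mul, Fin.cons_zero, Pi.zero_apply] at e
    rw [key (fun _ => 1)] at e
    simp only [mul_one] at e
    linarith
  have h1 : ∑ m ∈ S, w m • f m = ∑ m ∈ Sᶜ, w m • f m := by
    ext i
    have e := congrFun h i.succ
    simp only [Finset.sum_apply, Pi.smul_apply, smul_eq_mul, Fin.cons_succ, Pi.zero_apply] at e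
    rw [key (fun m => f m i)] at e
    simp
    linarith
  have hpos : 0 < ∑ m ∈ S, w m := by
    rw [← Finset.sum_add_sum_compl S] at hs
    linarith
  refine ⟨S.centerMass w f, ?_, ?_⟩
  · exact Finset.centerMass_mem_convexHull _ (fun m _ => hw m) hpos
      (fun m hm => ⟨m, hm, rfl⟩)
  · have : S.centerMass w f = Sᶜ.centerMass w f := by
      simp only [Finset.centerMass, h0, h1]
    rw [this]
    exact Finset.centerMass_mem_convexHull _ (fun m _ => hw m) (h0 ▸ hpos)
      (fun m hm => ⟨m, hm, rfl⟩)

end CH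

/-- **colorful Hadwiger-type theorem.** Let `(A i)` be a finite family
of nonempty convex sets in `ℝ^d` colored by `c : ι → Fin (k+2)` with all `k+2` color
classes nonempty, `0 ≤ k < d`.  If there is `φ : ι → ℝ^k` such that for every colorful
`(k+2)`-tuple `t` (one set from each class) and every partition of it into two parts
`S`, `Sᶜ`, disjointness of the convex hulls of the parts implies disjointness of the
convex hulls of the `φ`-images, then some color class has a hyperplane transversal. -/
theorem colorful_hadwiger
    {d k : ℕ} (hkd : k < d) {ι : Type*} [Fintype ι]
    (A : ι → Set (EuclideanSpace ℝ (Fin d)))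
    (hconv : ∀ i, Convex ℝ (A i)) (hne : ∀ i, (A i).Nonempty)
    (c : ι → Fin (k + 2)) (hsurj : Function.Surjective c)
    (φ : ι → EuclideanSpace ℝ (Fin k))
    (hφ : ∀ t : Fin (k + 2) → ι, (∀ j, c (t j) = j) →
      ∀ S : Finset (Fin (k + 2)),
        convexHull ℝ (⋃ j ∈ S, A (t j)) ∩ convexHull ℝ (⋃ j ∈ Sᶜ, A (t j)) = ∅ →
        convexHull ℝ ((fun j => φ (t j)) '' (S : Set (Fin (k + 2)))) ∩
          convexHull ℝ ((fun j => φ (t j)) '' ((Sᶜ : Finset (Fin (k + 2))) : Set (Fin (k + 2)))) = ∅) :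
    ∃ j : Fin (k + 2), ∃ (w : EuclideanSpace ℝ (Fin d)) (a : ℝ), w ≠ 0 ∧
      ∀ i, c i = j → (A i ∩ {x | ⟪x, w⟫ = a}).Nonempty := by
  classical
  by_contra hcon
  push Not at hcon
  obtain ⟨P, hfin, -, hPA, hPred⟩ := CH.finite_reduction (κ := Fin (k + 2)) A hne
  have hsep : ∀ z : (Fin (k + 1) → ℝ) × ℝ, z ≠ 0 → ∀ j, ∃ i b, c i = j ∧
      ∀ x ∈ P i, 0 < CH.sr b * (⟪x, CH.emb (k + 1) d hkd z.1⟫ - z.2) := by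
    rintro ⟨w, a⟩ hz j
    by_cases hw : w = 0
    · subst hw
      have ha : a ≠ 0 := by rintro rfl; exact hz rfl
      obtain ⟨i, hi⟩ := hsurj j
      rcases lt_or_gt_of_ne ha with h | h
      · exact ⟨i, true, hi, fun x _ => by simpa [CH.sr] using h⟩
      · exact ⟨i, false, hi, fun x _ => by simpa [CH.sr] using h⟩
    · have hw' : CH.emb (k + 1) d hkd w ≠ 0 := by
        intro h
        apply hw
        funext i
        rw [← CH.emb_apply (k + 1) d hkd w i, h]
        simp
      obtain ⟨i, hi, hi'⟩ := hcon j _ a hw'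
      obtain ⟨b, hb⟩ := CH.one_side (A i) (hconv i) (CH.emb (k + 1) d hkd w) a (by
        rw [hi']; exact Set.not_nonempty_empty)
      exact ⟨i, b, hi, fun x hx => hb x (hPA i hx)⟩
  obtain ⟨δ, L, hδ, hLodd, hL⟩ := CH.exists_labels (CH.emb (k + 1) d hkd) P hfin c hsep
  let vec : ι × Bool → Fin (k + 1) → ℝ := fun l =>
    CH.sr l.2 • (Fin.cons 1 (fun i => φ l.1 i) : Fin (k + 1) → ℝ)
  obtain ⟨N, hN⟩ := exists_nat_one_div_lt (lt_min hδ one_pos)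
  obtain ⟨x, p, w, hx, hpx, hw, hws, hsum⟩ := CH.colored_zero (n := k + 1) (N := N + 1)
    N.succ_pos (fun m p => vec (L m p)) (∑ l, ‖vec l‖)
    (fun m p => Finset.single_le_sum (f := fun l => ‖vec l‖) (fun _ _ => norm_nonneg _)
      (Finset.mem_univ _))
    (fun m p hp => by
      simp only [vec]
      rw [hLodd m p hp]
      simp only [CH.sr_not, neg_smul])
  have hd : ∀ m, dist (p m) x < min δ 1 := fun m => by
    refine (hpx m).trans_lt ?_
    push_cast
    exact hN
  have hp2 : ∀ m, ‖p m‖ ≤ 2 := fun m => by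
    have h1 := (hd m).trans_le (min_le_right _ _)
    rw [dist_eq_norm] at h1
    have h2 := norm_add_le (p m - x) x
    rw [sub_add_cancel] at h2
    linarith
  have hlab := fun m => hL m (p m) x (hp2 m) (by
    rw [dist_comm]; exact (hd m).trans_le (min_le_left _ _))
  let S : Finset (Fin (k + 2)) := Finset.univ.filter fun m => (L m (p m)).2 = true
  have hS : ∀ m, m ∈ S ↔ (L m (p m)).2 = true := fun m => by simp [S]
  have hdisj := hPred (fun m => (L m (p m)).1) S
    (CH.hulls_disj _ _ (CH.emb (k + 1) d hkd (CH.hm x).1) (CH.hm x).2 (by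
      intro y hy
      simp only [Set.mem_iUnion] at hy
      obtain ⟨m, hm, hy⟩ := hy
      have := (hlab m).2 y hy
      rw [(hS m).1 hm] at this
      simp only [CH.sr, if_true, one_mul] at this
      linarith) (by
      intro y hy
      simp only [Set.mem_iUnion] at hy
      obtain ⟨m, hm, hy⟩ := hy
      have := (hlab m).2 y hy
      have hf : (L m (p m)).2 = false := by
        rw [← Bool.not_eq_true, ← hS m]; exact Finset.mem_compl.1 hm
      rw [hf] at this
      simp [CH.sr] at this
      linarith))
  have hemp := hφ (fun m => (L m (p m)).1) (fun m => (hlab m).1) S hdisj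
  have hrad := CH.radon_point (fun m => φ (L m (p m)).1) (fun m => (L m (p m)).2) w hw hws
    hsum S hS
  rw [hemp] at hrad
  exact Set.not_nonempty_empty hrad
end
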